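/- Let s > 2k ≥ 4 and δ = 8^{−2k}. Then, for almost all λ ∈ Λ_k^{(s)} (with respect to Lebesgue measure), there exists a number P_0 = P_0(λ,k) such that the inequality |I_λ(P,η) − η J_{k,s}(λ) P^{s−k}| ≤ P^{s−k−5δ/2} holds for all P ≥ P_0, uniformly in 0 < η ≤ 2. -/

import Mathlib

open MeasureTheory

/-- e(t) = e^{2πit}. -/
noncomputable def eF (t : ℝ) : ℂ := Complex.exp (2 * Real.pi * Complex.I * t)

/-- v(α) = ∫_{−P}^{P} e(α ξ^k) dξ. -/
noncomputable def vInt (k : ℕ) (P α : ℝ) : ℂ := ∫ ξ in (-P)..P, eF (α * ξ ^ k)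

/-- The measure d_η α = η (sin(πηα)/(πηα))² dα on ℝ. -/
noncomputable def dEta (η : ℝ) : Measure ℝ :=
  volume.withDensity fun α =>
    ENNReal.ofReal (η * (Real.sin (Real.pi * η * α) / (Real.pi * η * α)) ^ 2)

/-- δ = 8^{−2k}. -/
noncomputable def dlt (k : ℕ) : ℝ := ((8 : ℝ) ^ (2 * k))⁻¹

/-- Λ_k^{(s)}: s-tuples of nonzero reals; for even k additionally some λ_i λ_j < 0. -/
def Lam (k s : ℕ) : Set (Fin s → ℝ) :=
  {l | (∀ j, l j ≠ 0) ∧ (Even k → ∃ i j, l i * l j < 0)}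

/-- Λ_k^{(s)}(C) = {λ ∈ Λ_k^{(s)} : 1/C ≤ |λ_j| ≤ C}. -/
def LamC (k s : ℕ) (C : ℝ) : Set (Fin s → ℝ) :=
  {l | l ∈ Lam k s ∧ ∀ j, 1 / C ≤ |l j| ∧ |l j| ≤ C}

/-- I_λ(P,η) = Σ_{x ∈ ℤ^s, |x| ≤ P} W_η(λ_1x_1^k + ⋯ + λ_sx_s^k),
where W_η(α) = max(0, 1 − |α|/η). -/
noncomputable def Icount (k s : ℕ) (l : Fin s → ℝ) (P η : ℝ) : ℝ :=
  ∑ x ∈ Fintype.piFinset (fun _ : Fin s => Finset.Icc (-(⌊P⌋ : ℤ)) ⌊P⌋),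
    max 0 (1 - |∑ j, l j * ((x j : ℤ) : ℝ) ^ k| / η)

lemma sum_rpow_neg_le {ρ : ℝ} (h0 : 0 ≤ ρ) (h1 : ρ ≤ 3 / 4) (N : ℕ) :
    ∑ m ∈ Finset.Icc 1 N, (m : ℝ) ^ (-ρ) ≤ 4 * (N : ℝ) ^ (1 - ρ) := by
  induction N with
  | zero => simp; positivity
  | succ N ih =>
    rw [Finset.sum_Icc_succ_top (by omega)]
    have hy : (0 : ℝ) < (N : ℝ) + 1 := by positivity
    have hb := rpow_one_add_le_one_add_mul_self (s := -(1 / ((N : ℝ) + 1))) (p := 1 - ρ)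
      (by rw [neg_le_neg_iff, div_le_one hy]; linarith [Nat.cast_nonneg (α := ℝ) N])
      (by linarith) (by linarith)
    have he : 1 + -(1 / ((N : ℝ) + 1)) = N / (N + 1) := by field_simp; ring
    rw [he, Real.div_rpow (by positivity) hy.le, div_le_iff₀ (by positivity)] at hb
    have hs : ((N : ℝ) + 1) ^ (1 - ρ) = (N + 1) ^ (-ρ) * (N + 1) := by
      rw [sub_eq_neg_add, Real.rpow_add_one hy.ne']
    have hp : 0 < ((N : ℝ) + 1) ^ (-ρ) := by positivity
    have hc : (1 + (1 - ρ) * -(1 / ((N : ℝ) + 1))) * ((N : ℝ) + 1) ^ (1 - ρ)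
        = ((N : ℝ) + 1) ^ (1 - ρ) - (1 - ρ) * ((N : ℝ) + 1) ^ (-ρ) := by
      rw [hs]; field_simp; ring
    rw [hc] at hb
    push_cast
    nlinarith

lemma sum_max_rpow_neg_le {ρ : ℝ} (h0 : 0 ≤ ρ) (h1 : ρ ≤ 3 / 4) {N : ℕ} (hN : 1 ≤ N) (c : ℝ) :
    ∑ n ∈ Finset.Icc (-(N : ℤ)) N, (max 1 |(n : ℝ) + c|) ^ (-ρ) ≤ 24 * (N : ℝ) ^ (1 - ρ) := by
  have hN' : (1 : ℝ) ≤ N := by exact_mod_cast hN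
  set n₀ : ℤ := round (-c) with hn₀
  set h : ℤ → ℝ := fun m ↦ (max 1 |(m : ℝ)|) ^ (-ρ) with hh
  have hpos : ∀ m, 0 ≤ h m := fun m ↦ by positivity
  have hr : |(-c) - n₀| ≤ 1 / 2 := abs_sub_round (-c)
  have h_shift : ∀ n : ℤ, (max 1 |(n : ℝ) + c|) ^ (-ρ) ≤ 2 * h (n - n₀) := by
    intro n
    have hle : max 1 |((n - n₀ : ℤ) : ℝ)| / 2 ≤ max 1 |(n : ℝ) + c| := by
      have h2 : |((n - n₀ : ℤ) : ℝ)| ≤ |(n : ℝ) + c| + 1 / 2 := by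
        have : ((n - n₀ : ℤ) : ℝ) = ((n : ℝ) + c) + (-c - n₀) := by push_cast; ring
        rw [this]
        exact (abs_add_le _ _).trans (by linarith)
      have a1 := le_max_left 1 |(n : ℝ) + c|
      have a2 := le_max_right 1 |(n : ℝ) + c|
      rcases max_cases 1 |((n - n₀ : ℤ) : ℝ)| with h | h <;> linarith
    calc (max 1 |(n : ℝ) + c|) ^ (-ρ) ≤ (max 1 |((n - n₀ : ℤ) : ℝ)| / 2) ^ (-ρ) :=
          Real.rpow_le_rpow_of_nonpos (by positivity) hle (by linarith)
      _ = h (n - n₀) * 2 ^ ρ := by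
          rw [Real.div_rpow (by positivity) (by norm_num), Real.rpow_neg (by norm_num : (0:ℝ) ≤ 2),
            div_inv_eq_mul]
      _ ≤ h (n - n₀) * 2 := by
          gcongr
          calc (2 : ℝ) ^ ρ ≤ 2 ^ (1 : ℝ) :=
                Real.rpow_le_rpow_of_exponent_le (by norm_num) (by linarith)
            _ = 2 := by simp
      _ = _ := by ring
  have h_outside : ∀ m : ℤ,
      h m ≤ (if m ∈ Finset.Icc (-(N : ℤ)) N then h m else 0) + (N : ℝ) ^ (-ρ) := by
    intro m
    split_ifs with hm
    · have : 0 ≤ (N : ℝ) ^ (-ρ) := by positivity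
      linarith
    · rw [zero_add]
      refine Real.rpow_le_rpow_of_nonpos (by positivity) ?_ (by linarith)
      refine le_max_of_le_right ?_
      rw [Finset.mem_Icc, ← abs_le, not_le] at hm
      rw [← Int.cast_abs]
      exact_mod_cast hm.le
  have h_sum : ∑ m ∈ Finset.Icc (-(N : ℤ)) N, h m ≤ 1 + 8 * (N : ℝ) ^ (1 - ρ) := by
    have hsub : Finset.Icc (-(N : ℤ)) N ⊆ {0} ∪ ((Finset.Icc 1 N).image (fun m : ℕ ↦ (m : ℤ)) ∪
        (Finset.Icc 1 N).image (fun m : ℕ ↦ -(m : ℤ))) := by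
      intro m hm
      simp only [Finset.mem_union, Finset.mem_singleton, Finset.mem_image, Finset.mem_Icc] at hm ⊢
      rcases lt_trichotomy m 0 with h | h | h
      · right; right; exact ⟨m.natAbs, by omega, by omega⟩
      · left; exact h
      · right; left; exact ⟨m.natAbs, by omega, by omega⟩
    have hval : ∀ m ∈ Finset.Icc 1 N, h (m : ℤ) = (m : ℝ) ^ (-ρ) ∧ h (-(m : ℤ)) = (m : ℝ) ^ (-ρ) := by
      intro m hm
      have : (1 : ℝ) ≤ m := by exact_mod_cast (Finset.mem_Icc.1 hm).1
      simp [hh, this]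
    have hs := sum_rpow_neg_le h0 h1 N
    calc _ ≤ ∑ m ∈ _, h m := Finset.sum_le_sum_of_subset_of_nonneg hsub (fun _ _ _ ↦ hpos _)
      _ ≤ ∑ m ∈ {0}, h m + (∑ m ∈ (Finset.Icc 1 N).image (fun m : ℕ ↦ (m : ℤ)), h m +
          ∑ m ∈ (Finset.Icc 1 N).image (fun m : ℕ ↦ -(m : ℤ)), h m) := by
          have hu : ∀ A B : Finset ℤ, ∑ m ∈ A ∪ B, h m ≤ ∑ m ∈ A, h m + ∑ m ∈ B, h m := by
            intro A B
            rw [← Finset.sum_union_inter]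
            linarith [Finset.sum_nonneg (s := A ∩ B) (fun m _ ↦ hpos m)]
          exact (hu _ _).trans (add_le_add le_rfl (hu _ _))
      _ ≤ 1 + (4 * (N : ℝ) ^ (1 - ρ) + 4 * (N : ℝ) ^ (1 - ρ)) := by
          rw [Finset.sum_image (by simp), Finset.sum_image (by simp),
            Finset.sum_congr rfl (fun m hm ↦ (hval m hm).1),
            Finset.sum_congr rfl (fun m hm ↦ (hval m hm).2)]
          gcongr
          simp [hh]
      _ = _ := by ring
  have h_filter : ∑ n ∈ Finset.Icc (-(N : ℤ)) N,
      (if n - n₀ ∈ Finset.Icc (-(N : ℤ)) N then h (n - n₀) else 0) ≤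
      ∑ m ∈ Finset.Icc (-(N : ℤ)) N, h m := by
    rw [← Finset.sum_filter]
    have hinj : Set.InjOn (fun n : ℤ ↦ n - n₀)
        ↑(Finset.filter (fun n ↦ n - n₀ ∈ Finset.Icc (-(N : ℤ)) N) (Finset.Icc (-(N : ℤ)) N)) := by
      intro a _ b _ hab
      simpa using hab
    rw [← Finset.sum_image (f := h) hinj]
    refine Finset.sum_le_sum_of_subset_of_nonneg ?_ (fun _ _ _ ↦ hpos _)
    intro m hm
    obtain ⟨n, hn, rfl⟩ := Finset.mem_image.1 hm
    exact (Finset.mem_filter.1 hn).2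
  have hsplit : (N : ℝ) ^ (1 - ρ) = (N : ℝ) ^ (-ρ) * N := by
    rw [sub_eq_neg_add, Real.rpow_add_one (by positivity)]
  have hone : 1 ≤ (N : ℝ) ^ (1 - ρ) := Real.one_le_rpow hN' (by linarith)
  have hcard : ((Finset.Icc (-(N : ℤ)) N).card : ℝ) = 2 * N + 1 := by
    rw [Int.card_Icc]
    have : ((N : ℤ) + 1 - -(N : ℤ)).toNat = 2 * N + 1 := by omega
    rw [this]; push_cast; ring
  calc _ ≤ ∑ n ∈ Finset.Icc (-(N : ℤ)) N,
        2 * ((if n - n₀ ∈ Finset.Icc (-(N : ℤ)) N then h (n - n₀) else 0) + (N : ℝ) ^ (-ρ)) :=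
        Finset.sum_le_sum fun n _ ↦ (h_shift n).trans
          (mul_le_mul_of_nonneg_left (h_outside _) (by norm_num))
    _ = 2 * (∑ n ∈ Finset.Icc (-(N : ℤ)) N,
        (if n - n₀ ∈ Finset.Icc (-(N : ℤ)) N then h (n - n₀) else 0) +
          (2 * N + 1) * (N : ℝ) ^ (-ρ)) := by
        rw [← Finset.mul_sum, Finset.sum_add_distrib, Finset.sum_const, nsmul_eq_mul, hcard]
    _ ≤ 2 * (1 + 8 * (N : ℝ) ^ (1 - ρ) + (3 * N) * (N : ℝ) ^ (-ρ)) := by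
        gcongr
        · exact h_filter.trans h_sum
        · linarith
    _ ≤ _ := by nlinarith

lemma sum_max_pow_sub_rpow_neg_le {k : ℕ} (hk : k ≠ 0) {μ : ℝ} (h0 : 0 ≤ μ)
    (h1 : k * μ ≤ 3 / 4) {N : ℕ} (hN : 1 ≤ N) (b c : ℝ) :
    ∑ n ∈ Finset.Icc (-(N : ℤ)) N, (max 1 |((n : ℝ) + b) ^ k - c|) ^ (-μ) ≤
      48 * (N : ℝ) ^ (1 - k * μ) := by
  have hsub : ∀ x y : ℝ, 0 ≤ x → 0 ≤ y → |x - y| ^ k ≤ |x ^ k - y ^ k| := by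
    have key : ∀ x y : ℝ, 0 ≤ y → y ≤ x → (x - y) ^ k ≤ x ^ k - y ^ k := by
      intro x y hy hxy
      have := pow_add_pow_le (sub_nonneg.2 hxy) hy hk
      rw [sub_add_cancel] at this
      linarith
    intro x y hx hy
    rcases le_total y x with h | h
    · rw [abs_of_nonneg (sub_nonneg.2 h)]
      exact (key x y hy h).trans (le_abs_self _)
    · rw [abs_sub_comm, abs_sub_comm (x ^ k), abs_of_nonneg (sub_nonneg.2 h)]
      exact (key y x hx h).trans (le_abs_self _)
  set r : ℝ := |c| ^ ((k : ℝ)⁻¹) with hr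
  have hrk : r ^ k = |c| := Real.rpow_inv_natCast_pow (abs_nonneg c) hk
  have hr0 : 0 ≤ r := by positivity
  have hpt : ∀ z : ℝ, (max 1 |z ^ k - c|) ^ (-μ) ≤
      (max 1 |z + -r|) ^ (-(k * μ)) + (max 1 |z + r|) ^ (-(k * μ)) := by
    intro z
    have h2 : abs (|z| - r) ^ k ≤ |z ^ k - c| := by
      refine (hsub _ _ (abs_nonneg z) hr0).trans ?_
      rw [hrk, ← abs_pow]
      exact abs_abs_sub_abs_le _ _
    have h3 : (max 1 |z ^ k - c|) ^ (-μ) ≤ (max 1 (abs (|z| - r))) ^ (-(k * μ)) := by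
      calc _ ≤ ((max 1 (abs (|z| - r))) ^ k) ^ (-μ) := by
            refine Real.rpow_le_rpow_of_nonpos (by positivity) ?_ (by linarith)
            rcases max_cases 1 (abs (|z| - r)) with h | h
            · rw [h.1, one_pow]; exact le_max_left _ _
            · rw [h.1]; exact h2.trans (le_max_right _ _)
        _ = _ := by
            rw [← Real.rpow_natCast, ← Real.rpow_mul (by positivity)]; ring_nf
    have p1 : 0 ≤ (max 1 |z + -r|) ^ (-(k * μ)) := by positivity
    have p2 : 0 ≤ (max 1 |z + r|) ^ (-(k * μ)) := by positivity
    rcases abs_cases z with h | h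
    · rw [h.1, sub_eq_add_neg z r] at h3
      linarith
    · have : abs (|z| - r) = |z + r| := by
        rw [h.1, ← abs_neg]; ring_nf
      rw [this] at h3
      linarith
  calc _ ≤ ∑ n ∈ Finset.Icc (-(N : ℤ)) N, ((max 1 |(n : ℝ) + (b + -r)|) ^ (-(k * μ)) +
        (max 1 |(n : ℝ) + (b + r)|) ^ (-(k * μ))) :=
        Finset.sum_le_sum fun n _ ↦ by simpa only [add_assoc] using hpt ((n : ℝ) + b)
    _ ≤ 24 * (N : ℝ) ^ (1 - k * μ) + 24 * (N : ℝ) ^ (1 - k * μ) := by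
        rw [Finset.sum_add_distrib]
        have : 0 ≤ k * μ := by positivity
        exact add_le_add (sum_max_rpow_neg_le this h1 hN _) (sum_max_rpow_neg_le this h1 hN _)
    _ = _ := by ring

/-- The Gram determinant of two vectors. -/
noncomputable def gramDet {s : ℕ} (u v : EuclideanSpace ℝ (Fin s)) : ℝ :=
  ‖u‖ ^ 2 * ‖v‖ ^ 2 - inner ℝ u v ^ 2

/-- The larger of `1`, the norms of two vectors and the area they span. -/
noncomputable def gramSize {s : ℕ} (u v : EuclideanSpace ℝ (Fin s)) : ℝ :=
  max (max 1 ‖u‖) (max ‖v‖ (√(gramDet u v)))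

/-- The vector with coordinates `(x j + a j) ^ k`. -/
noncomputable def shiftPow {s : ℕ} (k : ℕ) (a : Fin s → ℝ) (x : Fin s → ℤ) :
    EuclideanSpace ℝ (Fin s) :=
  WithLp.toLp 2 fun j ↦ ((x j : ℝ) + a j) ^ k

/-- The integer points of the cube `[-N, N]^s`. -/
noncomputable def intCube (s N : ℕ) : Finset (Fin s → ℤ) :=
  Fintype.piFinset fun _ ↦ Finset.Icc (-(N : ℤ)) N

lemma two_mul_gramDet {s : ℕ} (u v : EuclideanSpace ℝ (Fin s)) :
    2 * gramDet u v = ∑ i, ∑ j, (u i * v j - u j * v i) ^ 2 := by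
  have h1 : ∀ i j, (u i * v j - u j * v i) ^ 2 =
      u i ^ 2 * v j ^ 2 + v i ^ 2 * u j ^ 2 - 2 * ((u i * v i) * (u j * v j)) := fun i j ↦ by ring
  simp_rw [h1, Finset.sum_sub_distrib, Finset.sum_add_distrib, ← Finset.mul_sum,
    ← Finset.sum_mul]
  rw [gramDet, EuclideanSpace.real_norm_sq_eq, EuclideanSpace.real_norm_sq_eq, PiLp.inner_apply]
  simp only [RCLike.inner_apply, conj_trivial, mul_comm (v _) (u _)]
  ring

lemma gramDet_nonneg {s : ℕ} (u v : EuclideanSpace ℝ (Fin s)) : 0 ≤ gramDet u v := by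
  have := two_mul_gramDet u v
  have : 0 ≤ ∑ i, ∑ j, (u i * v j - u j * v i) ^ 2 := by positivity
  linarith

lemma abs_minor_le_sqrt_gramDet {s : ℕ} (u v : EuclideanSpace ℝ (Fin s)) (i j : Fin s) :
    |u i * v j - u j * v i| ≤ √(gramDet u v) := by
  rcases eq_or_ne i j with rfl | hij
  · simp
  apply Real.abs_le_sqrt
  have h2 := two_mul_gramDet u v
  rw [← Finset.sum_product'] at h2
  have h3 : ∑ p ∈ {(i, j), (j, i)}, (u p.1 * v p.2 - u p.2 * v p.1) ^ 2 ≤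
      ∑ p ∈ Finset.univ ×ˢ Finset.univ, (u p.1 * v p.2 - u p.2 * v p.1) ^ 2 :=
    Finset.sum_le_sum_of_subset_of_nonneg (by intro p; simp) (fun _ _ _ ↦ sq_nonneg _)
  rw [Finset.sum_pair (by simp [hij])] at h3
  simp only at h3
  nlinarith

lemma abs_apply_le_norm {s : ℕ} (u : EuclideanSpace ℝ (Fin s)) (i : Fin s) : |u i| ≤ ‖u‖ := by
  simpa using PiLp.norm_apply_le u i

lemma exists_le_gramSize {s : ℕ} (hs : 0 < s) (u : EuclideanSpace ℝ (Fin s)) :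
    ∃ (i₀ : Fin s) (t : Fin s → ℝ), ∀ (v : EuclideanSpace ℝ (Fin s)) (i j : Fin s), j ≠ i₀ →
      max 1 |u i| * max 1 |v j - t j * v i₀| ≤ gramSize u v := by
  have : Nonempty (Fin s) := ⟨⟨0, hs⟩⟩
  obtain ⟨i₀, hi₀⟩ := Finite.exists_max fun i ↦ |u i|
  have aux : ∀ v : EuclideanSpace ℝ (Fin s), 1 ≤ gramSize u v ∧ ‖u‖ ≤ gramSize u v ∧
      ‖v‖ ≤ gramSize u v ∧ √(gramDet u v) ≤ gramSize u v := fun v ↦ by simp [gramSize]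
  rcases lt_or_ge |u i₀| 1 with h | h
  · refine ⟨i₀, 0, fun v i j _ ↦ ?_⟩
    obtain ⟨h1, -, h3, -⟩ := aux v
    rw [max_eq_left ((hi₀ i).trans h.le)]
    simpa using ⟨h1, (abs_apply_le_norm v j).trans h3⟩
  · refine ⟨i₀, fun j ↦ u j / u i₀, fun v i j _ ↦ ?_⟩
    obtain ⟨h1, h2, -, h4⟩ := aux v
    have h0 : u i₀ ≠ 0 := by rintro h'; rw [h'] at h; norm_num at h
    calc _ ≤ |u i₀| * max 1 |v j - u j / u i₀ * v i₀| := by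
          gcongr; exact max_le h (hi₀ i)
      _ = max |u i₀| |u i₀ * v j - u j * v i₀| := by
          rw [mul_max_of_nonneg _ _ (abs_nonneg _), mul_one, ← abs_mul]
          congr 2; field_simp
      _ ≤ _ := max_le ((abs_apply_le_norm u i₀).trans h2)
          ((abs_minor_le_sqrt_gramDet u v i₀ j).trans h4)

lemma rpow_neg_le_prod {ι : Type*} (A : Finset ι) {Z : ℝ} {c : ι → ℝ} (hc : ∀ j ∈ A, 1 ≤ c j)
    (hA : A.Nonempty) (hZ : ∀ j ∈ A, c j ≤ Z) {κ : ℝ} (hκ : 0 ≤ κ) :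
    Z ^ (-κ) ≤ ∏ j ∈ A, c j ^ (-(κ / A.card)) := by
  have hcard : (0 : ℝ) < A.card := by exact_mod_cast hA.card_pos
  obtain ⟨j₀, hj₀⟩ := hA
  have hZ0 : 0 < Z := lt_of_lt_of_le one_pos ((hc _ hj₀).trans (hZ _ hj₀))
  calc Z ^ (-κ) = ∏ j ∈ A, Z ^ (-(κ / A.card)) := by
        rw [Finset.prod_const, ← Real.rpow_mul_natCast hZ0.le]
        congr 1; field_simp
    _ ≤ _ := Finset.prod_le_prod (fun _ _ ↦ by positivity) fun j hj ↦
        Real.rpow_le_rpow_of_nonpos (by linarith [hc j hj]) (hZ j hj)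
          (by have : 0 ≤ κ / A.card := by positivity
              linarith)

lemma sum_rpow_norm_le {s k : ℕ} (hk : k ≠ 0) (hs : 2 * k < s) {N : ℕ} (hN : 1 ≤ N)
    (a : Fin s → ℝ) (f : (Fin s → ℤ) → ℝ) (hf : ∀ x i, max 1 |shiftPow k a x i| ≤ f x) :
    ∑ x ∈ intCube s N, f x ^ (-(3 / 2) : ℝ) ≤ 48 ^ s * (N : ℝ) ^ ((s : ℝ) - 3 / 2 * k) := by
  have hs0 : (0 : ℝ) < s := by exact_mod_cast (by omega : 0 < s)
  have hsk : (2 : ℝ) * k ≤ s := by exact_mod_cast hs.le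
  have : Nonempty (Fin s) := ⟨⟨0, by omega⟩⟩
  calc _ ≤ ∑ x ∈ intCube s N, ∏ j, (max 1 |((x j : ℝ) + a j) ^ k - 0|) ^ (-(3 / 2 / (s : ℝ))) := by
        refine Finset.sum_le_sum fun x _ ↦ ?_
        have := rpow_neg_le_prod (Finset.univ : Finset (Fin s)) (Z := f x)
          (c := fun j ↦ max 1 |shiftPow k a x j|) (fun _ _ ↦ le_max_left _ _)
          Finset.univ_nonempty (fun j _ ↦ hf x j) (κ := 3 / 2) (by norm_num)
        simpa [shiftPow] using this
    _ = ∏ j : Fin s, ∑ n ∈ Finset.Icc (-(N : ℤ)) N,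
          (max 1 |((n : ℝ) + a j) ^ k - 0|) ^ (-(3 / 2 / (s : ℝ))) := by
        rw [Finset.prod_univ_sum]; rfl
    _ ≤ ∏ _j : Fin s, 48 * (N : ℝ) ^ (1 - k * (3 / 2 / (s : ℝ))) := by
        refine Finset.prod_le_prod (fun _ _ ↦ by positivity) fun j _ ↦
          sum_max_pow_sub_rpow_neg_le hk (by positivity) ?_ hN _ _
        rw [mul_div_assoc', div_le_iff₀ hs0]; linarith
    _ = _ := by
        rw [Finset.prod_const, Finset.card_univ, Fintype.card_fin, mul_pow,
          ← Real.rpow_mul_natCast (by positivity)]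
        congr 2; field_simp

lemma sum_rpow_dist_line_le {s k : ℕ} (hk : k ≠ 0) (hs : 2 * k < s) {N : ℕ} (hN : 1 ≤ N)
    (b : Fin s → ℝ) (i₀ : Fin s) (t : Fin s → ℝ) (f : (Fin s → ℤ) → ℝ)
    (hf : ∀ y j, j ≠ i₀ → max 1 |shiftPow k b y j - t j * shiftPow k b y i₀| ≤ f y) :
    ∑ y ∈ intCube s N, f y ^ (-(3 / 2) : ℝ) ≤
      3 * 48 ^ (s - 1) * (N : ℝ) ^ ((s : ℝ) - 3 / 2 * k) := by
  have hs1 : 0 < s - 1 := by omega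
  have hs0 : (0 : ℝ) < (s - 1 : ℕ) := by exact_mod_cast hs1
  have hsk : (2 : ℝ) * k ≤ (s - 1 : ℕ) := by exact_mod_cast (by omega : 2 * k ≤ s - 1)
  have hN0 : (1 : ℝ) ≤ N := by exact_mod_cast hN
  set μ : ℝ := 3 / 2 / ((s - 1 : ℕ) : ℝ) with hμ
  have hcard : (Finset.univ.erase i₀).card = s - 1 := by simp
  set h : ℤ → Fin s → ℤ → ℝ := fun m j n ↦ if j = i₀ then (if n = m then 1 else 0) else
    (max 1 |((n : ℝ) + b j) ^ k - t j * ((m : ℝ) + b i₀) ^ k|) ^ (-μ) with hh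
  have hpos : ∀ m j n, 0 ≤ h m j n := by
    intro m j n; simp only [hh]; split_ifs <;> positivity
  have hprod : ∀ m (y : Fin s → ℤ), ∏ j, h m j (y j) = (if y i₀ = m then 1 else 0) *
      ∏ j ∈ Finset.univ.erase i₀,
        (max 1 |((y j : ℝ) + b j) ^ k - t j * ((m : ℝ) + b i₀) ^ k|) ^ (-μ) := by
    intro m y
    rw [← Finset.mul_prod_erase Finset.univ _ (Finset.mem_univ i₀)]
    congr 1
    · simp [hh]
    · exact Finset.prod_congr rfl fun j hj ↦ by simp [hh, Finset.ne_of_mem_erase hj]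
  calc _ ≤ ∑ y ∈ intCube s N, ∑ m ∈ Finset.Icc (-(N : ℤ)) N, ∏ j, h m j (y j) := by
        refine Finset.sum_le_sum fun y hy ↦ ?_
        have hy0 : y i₀ ∈ Finset.Icc (-(N : ℤ)) N := Fintype.mem_piFinset.1 hy i₀
        refine le_trans ?_ (Finset.single_le_sum (fun m _ ↦ Finset.prod_nonneg
          fun j _ ↦ hpos m j (y j)) hy0)
        rw [hprod, if_pos rfl, one_mul]
        have := rpow_neg_le_prod (Finset.univ.erase i₀) (Z := f y)
          (c := fun j ↦ max 1 |shiftPow k b y j - t j * shiftPow k b y i₀|)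
          (fun _ _ ↦ le_max_left _ _) (Finset.card_pos.1 (by omega))
          (fun j hj ↦ hf y j (Finset.ne_of_mem_erase hj)) (κ := 3 / 2) (by norm_num)
        rw [hcard] at this
        exact this
    _ = ∑ m ∈ Finset.Icc (-(N : ℤ)) N, ∏ j, ∑ n ∈ Finset.Icc (-(N : ℤ)) N, h m j n := by
        rw [Finset.sum_comm]
        refine Finset.sum_congr rfl fun m _ ↦ ?_
        rw [Finset.prod_univ_sum]; rfl
    _ ≤ ∑ _m ∈ Finset.Icc (-(N : ℤ)) N, (48 * (N : ℝ) ^ (1 - k * μ)) ^ (s - 1) := by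
        refine Finset.sum_le_sum fun m hm ↦ ?_
        rw [← Finset.mul_prod_erase Finset.univ _ (Finset.mem_univ i₀)]
        have h1 : ∑ n ∈ Finset.Icc (-(N : ℤ)) N, h m i₀ n = 1 := by
          simp only [hh, if_true, Finset.sum_ite_eq', hm]
        rw [h1, one_mul, ← hcard, ← Finset.prod_const]
        refine Finset.prod_le_prod (fun _ _ ↦ Finset.sum_nonneg fun _ _ ↦ hpos _ _ _) fun j hj ↦ ?_
        simp only [hh, Finset.ne_of_mem_erase hj, if_false]
        refine sum_max_pow_sub_rpow_neg_le hk (by positivity) ?_ hN _ _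
        rw [hμ, mul_div_assoc', div_le_iff₀ hs0]; linarith
    _ = (2 * N + 1) * (48 ^ (s - 1) * (N : ℝ) ^ ((s : ℝ) - 1 - 3 / 2 * k)) := by
        rw [Finset.sum_const, nsmul_eq_mul, Int.card_Icc, mul_pow,
          ← Real.rpow_mul_natCast (by positivity)]
        have h1 : ((N : ℤ) + 1 - -(N : ℤ)).toNat = 2 * N + 1 := by omega
        have h2 : (1 - k * μ) * ((s - 1 : ℕ) : ℝ) = (s : ℝ) - 1 - 3 / 2 * k := by
          rw [hμ, sub_mul, mul_assoc, div_mul_cancel₀ _ hs0.ne', Nat.cast_sub (by omega)]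
          push_cast; ring
        rw [h1, h2]; push_cast; ring
    _ ≤ (3 * N) * (48 ^ (s - 1) * (N : ℝ) ^ ((s : ℝ) - 1 - 3 / 2 * k)) := by gcongr; linarith
    _ = _ := by
        have : (N : ℝ) ^ ((s : ℝ) - 3 / 2 * k) = (N : ℝ) ^ ((s : ℝ) - 1 - 3 / 2 * k) * N := by
          rw [← Real.rpow_add_one (by positivity)]; congr 1; ring
        rw [this]; ring

lemma sum_gramSize_rpow_le {s k : ℕ} (hk : k ≠ 0) (hs : 2 * k < s) {N : ℕ} (hN : 1 ≤ N)
    (a b : Fin s → ℝ) :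
    ∑ x ∈ intCube s N, ∑ y ∈ intCube s N,
      gramSize (shiftPow k a x) (shiftPow k b y) ^ (-(3 / 2) : ℝ) ≤
        3 * 48 ^ (2 * s) * (N : ℝ) ^ (2 * (s : ℝ) - 3 * k) := by
  have hs0 : 0 < s := by omega
  have : Nonempty (Fin s) := ⟨⟨0, hs0⟩⟩
  have hN0 : (0 : ℝ) < N := by exact_mod_cast hN
  set g : (Fin s → ℤ) → ℝ := fun x ↦ Finset.univ.sup' Finset.univ_nonempty
    fun i ↦ max 1 |shiftPow k a x i| with hg
  have hgi : ∀ x i, max 1 |shiftPow k a x i| ≤ g x := fun x i ↦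
    Finset.le_sup' (fun i ↦ max 1 |shiftPow k a x i|) (Finset.mem_univ i)
  have hg1 : ∀ x, 1 ≤ g x := fun x ↦ (le_max_left _ _).trans (hgi x ⟨0, hs0⟩)
  have inner : ∀ x, ∑ y ∈ intCube s N,
      gramSize (shiftPow k a x) (shiftPow k b y) ^ (-(3 / 2) : ℝ) ≤
      g x ^ (-(3 / 2) : ℝ) * (3 * 48 ^ (s - 1) * (N : ℝ) ^ ((s : ℝ) - 3 / 2 * k)) := by
    intro x
    obtain ⟨i₀, t, ht⟩ := exists_le_gramSize hs0 (shiftPow k a x)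
    have hgx : 0 < g x := lt_of_lt_of_le one_pos (hg1 x)
    have key : ∀ y j, j ≠ i₀ → max 1 |shiftPow k b y j - t j * shiftPow k b y i₀| ≤
        gramSize (shiftPow k a x) (shiftPow k b y) / g x := by
      intro y j hj
      rw [le_div_iff₀ hgx]
      obtain ⟨i, -, hi⟩ := Finset.exists_mem_eq_sup' Finset.univ_nonempty
        fun i ↦ max 1 |shiftPow k a x i|
      rw [hg]; simp only; rw [hi, mul_comm]
      exact ht _ i j hj
    have := sum_rpow_dist_line_le hk hs hN b i₀ t _ key
    calc _ = g x ^ (-(3 / 2) : ℝ) * ∑ y ∈ intCube s N,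
          (gramSize (shiftPow k a x) (shiftPow k b y) / g x) ^ (-(3 / 2) : ℝ) := by
          rw [Finset.mul_sum]
          refine Finset.sum_congr rfl fun y _ ↦ ?_
          have : 0 ≤ gramSize (shiftPow k a x) (shiftPow k b y) :=
            zero_le_one.trans ((le_max_left _ _).trans (le_max_left _ _))
          rw [Real.div_rpow this hgx.le]
          have : g x ^ (-(3 / 2) : ℝ) ≠ 0 := by positivity
          field_simp
      _ ≤ _ := by gcongr
  calc _ ≤ ∑ x ∈ intCube s N,
        g x ^ (-(3 / 2) : ℝ) * (3 * 48 ^ (s - 1) * (N : ℝ) ^ ((s : ℝ) - 3 / 2 * k)) :=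
        Finset.sum_le_sum fun x _ ↦ inner x
    _ ≤ (48 ^ s * (N : ℝ) ^ ((s : ℝ) - 3 / 2 * k)) *
        (3 * 48 ^ s * (N : ℝ) ^ ((s : ℝ) - 3 / 2 * k)) := by
        rw [← Finset.sum_mul]
        gcongr
        · exact sum_rpow_norm_le hk hs hN a g hgi
        · norm_num
        · omega
    _ = _ := by
        have : (N : ℝ) ^ (2 * (s : ℝ) - 3 * k) =
            (N : ℝ) ^ ((s : ℝ) - 3 / 2 * k) * (N : ℝ) ^ ((s : ℝ) - 3 / 2 * k) := by
          rw [← Real.rpow_add hN0]; congr 1; ring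
        rw [this]; ring

section
variable {s k : ℕ}

lemma abs_shiftPow_le {N : ℕ} (hN : 1 ≤ N) {a : Fin s → ℝ} (ha : ∀ j, |a j| ≤ 1 / 2)
    {x : Fin s → ℤ} (hx : x ∈ intCube s N) (j : Fin s) :
    |shiftPow k a x j| ≤ (2 * (N : ℝ)) ^ k := by
  have hN' : (1 : ℝ) ≤ N := by exact_mod_cast hN
  have h1 : |(x j : ℝ)| ≤ N := by
    rw [← Int.cast_abs]; exact_mod_cast abs_le.2 (Finset.mem_Icc.1 (Fintype.mem_piFinset.1 hx j))
  simp only [shiftPow, abs_pow]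
  gcongr
  exact (abs_add_le _ _).trans (by linarith [ha j])

lemma abs_shiftPow_sub_le {N : ℕ} (hN : 1 ≤ N) {a : Fin s → ℝ} (ha : ∀ j, |a j| ≤ 1 / 2)
    {x : Fin s → ℤ} (hx : x ∈ intCube s N) (j : Fin s) :
    |shiftPow k a x j - shiftPow k 0 x j| ≤ k * (2 * (N : ℝ)) ^ k / (4 * N) := by
  have hN' : (1 : ℝ) ≤ N := by exact_mod_cast hN
  have h1 : |(x j : ℝ)| ≤ N := by
    rw [← Int.cast_abs]; exact_mod_cast abs_le.2 (Finset.mem_Icc.1 (Fintype.mem_piFinset.1 hx j))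
  have h2 : |(x j : ℝ) + a j| ≤ 2 * N := (abs_add_le _ _).trans (by linarith [ha j])
  rcases Nat.eq_zero_or_pos k with rfl | hk
  · simp [shiftPow]
  have h3 := abs_pow_sub_pow_le ((x j : ℝ) + a j) (x j) k
  rw [add_sub_cancel_left] at h3
  have h4 : (2 * (N : ℝ)) ^ k = (2 * N) ^ (k - 1) * (2 * N) := by
    rw [← pow_succ, Nat.sub_add_cancel hk]
  calc |shiftPow k a x j - shiftPow k 0 x j| = |((x j : ℝ) + a j) ^ k - (x j : ℝ) ^ k| := by
        simp [shiftPow]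
    _ ≤ 1 / 2 * k * (2 * N) ^ (k - 1) := by
        refine h3.trans ?_
        gcongr
        · exact ha j
        · exact max_le h2 (by linarith)
    _ = _ := by rw [h4]; field_simp; norm_num

lemma abs_gramDet_sub_le {u v u' v' : EuclideanSpace ℝ (Fin s)} {U e : ℝ}
    (hu : ∀ j, |u j| ≤ U) (hv : ∀ j, |v j| ≤ U) (hu' : ∀ j, |u' j| ≤ U) (hv' : ∀ j, |v' j| ≤ U)
    (hue : ∀ j, |u' j - u j| ≤ e) (hve : ∀ j, |v' j - v j| ≤ e) :
    |gramDet u' v' - gramDet u v| ≤ 8 * s ^ 2 * U ^ 3 * e := by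
  have hterm : ∀ i j, |(u' i * v' j - u' j * v' i) ^ 2 - (u i * v j - u j * v i) ^ 2| ≤
      16 * U ^ 3 * e := by
    intro i j
    have hU : 0 ≤ U := (abs_nonneg _).trans (hu i)
    have he : 0 ≤ e := (abs_nonneg _).trans (hue i)
    have m1 : ∀ p q : ℝ, |p| ≤ U → |q| ≤ U → |p * q| ≤ U * U := fun p q hp hq ↦ by
      rw [abs_mul]; gcongr
    have m2 : ∀ p q : ℝ, |p| ≤ e → |q| ≤ U → |p * q| ≤ e * U := fun p q hp hq ↦ by
      rw [abs_mul]; gcongr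
    have hsum : |(u' i * v' j - u' j * v' i) + (u i * v j - u j * v i)| ≤ 4 * (U * U) := by
      have b1 := abs_le.1 (m1 _ _ (hu' i) (hv' j))
      have b2 := abs_le.1 (m1 _ _ (hu' j) (hv' i))
      have b3 := abs_le.1 (m1 _ _ (hu i) (hv j))
      have b4 := abs_le.1 (m1 _ _ (hu j) (hv i))
      rw [abs_le]; constructor <;> linarith
    have hdiff : |(u' i * v' j - u' j * v' i) - (u i * v j - u j * v i)| ≤ 4 * (e * U) := by
      have b1 := abs_le.1 (m2 _ _ (hue i) (hv' j))
      have b2 := abs_le.1 (m2 _ _ (hve j) (hu i))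
      have b3 := abs_le.1 (m2 _ _ (hue j) (hv' i))
      have b4 := abs_le.1 (m2 _ _ (hve i) (hu j))
      rw [abs_le]; constructor <;> linarith
    rw [sq_sub_sq, abs_mul]
    calc _ ≤ 4 * (U * U) * (4 * (e * U)) := by gcongr
      _ = _ := by ring
  have h1 : 2 * (gramDet u' v' - gramDet u v) =
      ∑ i, ∑ j, ((u' i * v' j - u' j * v' i) ^ 2 - (u i * v j - u j * v i) ^ 2) := by
    simp_rw [Finset.sum_sub_distrib]
    rw [mul_sub, two_mul_gramDet, two_mul_gramDet]
  have h2 : |2 * (gramDet u' v' - gramDet u v)| ≤ ∑ _i : Fin s, ∑ _j : Fin s, 16 * U ^ 3 * e := by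
    rw [h1]
    refine (Finset.abs_sum_le_sum_abs _ _).trans (Finset.sum_le_sum fun i _ ↦ ?_)
    exact (Finset.abs_sum_le_sum_abs _ _).trans (Finset.sum_le_sum fun j _ ↦ hterm i j)
  rw [abs_mul, abs_two] at h2
  simp only [Finset.sum_const, Finset.card_univ, Fintype.card_fin, nsmul_eq_mul] at h2
  nlinarith

lemma norm_le_of_abs_apply_le (hs : 0 < s) {u : EuclideanSpace ℝ (Fin s)} {U : ℝ}
    (hu : ∀ j, |u j| ≤ U) : ‖u‖ ≤ s * U := by
  have hU : 0 ≤ U := (abs_nonneg _).trans (hu ⟨0, hs⟩)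
  have hs' : (1 : ℝ) ≤ s := by exact_mod_cast hs
  rw [EuclideanSpace.norm_eq]
  refine Real.sqrt_le_iff.2 ⟨by positivity, ?_⟩
  calc ∑ i, ‖u i‖ ^ 2 ≤ ∑ _i : Fin s, U ^ 2 := by
        gcongr with i; exact hu i
    _ = s * U ^ 2 := by simp
    _ ≤ (s * U) ^ 2 := by rw [mul_pow]; gcongr; nlinarith

lemma abs_inv_max_sub_inv_max_le {D D' τ : ℝ} (hτ : 0 < τ) (hD : 0 ≤ D) (hD' : 0 ≤ D') :
    |(max (√D') τ)⁻¹ - (max (√D) τ)⁻¹| ≤ |D' - D| / τ ^ 3 := by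
  set p := max (√D') τ with hp
  set q := max (√D) τ with hq
  have hpτ : τ ≤ p := le_max_right _ _
  have hqτ : τ ≤ q := le_max_right _ _
  have hp0 : 0 < p := hτ.trans_le hpτ
  have hq0 : 0 < q := hτ.trans_le hqτ
  have hsq : ∀ E : ℝ, 0 ≤ E → (max (√E) τ) ^ 2 = max E (τ ^ 2) := by
    intro E hE
    rcases le_total (√E) τ with h | h
    · rw [max_eq_right h, max_eq_right]
      exact (Real.sqrt_le_left hτ.le).1 h
    · rw [max_eq_left h, Real.sq_sqrt hE, max_eq_left]
      exact (Real.le_sqrt hτ.le hE).1 h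
  have hpq : |p ^ 2 - q ^ 2| ≤ |D' - D| := by
    rw [hp, hq, hsq _ hD', hsq _ hD]
    simpa using abs_max_sub_max_le_abs D' D (τ ^ 2)
  have heq : p⁻¹ - q⁻¹ = -(p ^ 2 - q ^ 2) / (p * q * (p + q)) := by
    field_simp; ring
  rw [heq, abs_div, abs_neg, abs_of_pos (by positivity : 0 < p * q * (p + q))]
  have hden : τ ^ 3 ≤ p * q * (p + q) := by
    calc τ ^ 3 = τ * τ * τ := by ring
      _ ≤ p * q * (p + q) := by gcongr; linarith
  gcongr

/-- A pair correlation `κ` of `W_η` at shifted lattice points, controlled by the Gram data of the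
points, is close to a main term which does not depend on the shifts. -/
lemma abs_sub_inv_max_le (hk : 1 ≤ k) (hs : 0 < s) {N : ℕ} (hN : 1 ≤ N) {a b : Fin s → ℝ}
    (ha : ∀ j, |a j| ≤ 1 / 2) (hb : ∀ j, |b j| ≤ 1 / 2) {x y : Fin s → ℤ}
    (hx : x ∈ intCube s N) (hy : y ∈ intCube s N) {κ c : ℝ} (hκ0 : 0 ≤ κ) (hc0 : 0 ≤ c)
    (hc1 : c ≤ 1) (hκ1 : κ ≤ 2 / gramSize (shiftPow k a x) (shiftPow k b y))
    (hκ2 : 0 < gramDet (shiftPow k a x) (shiftPow k b y) →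
      |κ - c / √(gramDet (shiftPow k a x) (shiftPow k b y))| ≤
        4 * (‖shiftPow k a x‖ ^ 2 + ‖shiftPow k b y‖ ^ 2) /
          √(gramDet (shiftPow k a x) (shiftPow k b y)) ^ 3) :
    |κ - c * (max (√(gramDet (shiftPow k 0 x) (shiftPow k 0 y)))
        ((N : ℝ) ^ (2 * (k : ℝ) - 1 / 4)))⁻¹| ≤
      (2 * s ^ 2 * k * 16 ^ k + 8 * s ^ 2 * 4 ^ k + 3 * (s * 2 ^ k) ^ 2) *
        ((N : ℝ) ^ (-2 * (k : ℝ) - 1 / 4) + (N : ℝ) ^ ((k : ℝ) - 1 / 8) *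
          gramSize (shiftPow k a x) (shiftPow k b y) ^ (-(3 / 2) : ℝ)) := by
  have hN' : (1 : ℝ) ≤ N := by exact_mod_cast hN
  have hN0 : (0 : ℝ) < N := by positivity
  have hk' : (1 : ℝ) ≤ k := by exact_mod_cast hk
  have hs' : (1 : ℝ) ≤ s := by exact_mod_cast hs
  set u' := shiftPow k a x
  set v' := shiftPow k b y
  set u := shiftPow k 0 x
  set v := shiftPow k 0 y
  set U : ℝ := (2 * (N : ℝ)) ^ k with hU
  set τ : ℝ := (N : ℝ) ^ (2 * (k : ℝ) - 1 / 4) with hτ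
  have hτ0 : 0 < τ := by positivity
  set Z := gramSize u' v' with hZ
  have hz : ∀ j : Fin s, |(0 : Fin s → ℝ) j| ≤ 1 / 2 := fun j ↦ by simp
  have hUN : U = 2 ^ k * (N : ℝ) ^ (k : ℝ) := by rw [hU, mul_pow, Real.rpow_natCast]
  have hu' : ∀ j, |u' j| ≤ U := abs_shiftPow_le hN ha hx
  have hv' : ∀ j, |v' j| ≤ U := abs_shiftPow_le hN hb hy
  have hD := abs_gramDet_sub_le (abs_shiftPow_le (k := k) hN hz hx)
    (abs_shiftPow_le (k := k) hN hz hy) hu' hv' (abs_shiftPow_sub_le hN ha hx)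
    (abs_shiftPow_sub_le hN hb hy)
  have hDN : 8 * (s : ℝ) ^ 2 * U ^ 3 * (k * U / (4 * N)) =
      2 * s ^ 2 * k * 16 ^ k * (N : ℝ) ^ (4 * (k : ℝ) - 1) := by
    have h1 : (N : ℝ) ^ (4 * (k : ℝ) - 1) = ((N : ℝ) ^ (k : ℝ)) ^ 4 / N := by
      rw [Real.rpow_sub_one hN0.ne', mul_comm, Real.rpow_mul hN0.le]
      norm_cast
    have h2 : (16 : ℝ) ^ k = (2 ^ k) ^ 4 := by rw [← pow_mul, mul_comm, pow_mul]; norm_num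
    rw [hUN, h1, h2]; field_simp; norm_num
  have hτ3 : τ ^ 3 = (N : ℝ) ^ (6 * (k : ℝ) - 3 / 4) := by
    rw [hτ, ← Real.rpow_mul_natCast hN0.le]; congr 1; push_cast; ring
  have hφ : |(max (√(gramDet u' v')) τ)⁻¹ - (max (√(gramDet u v)) τ)⁻¹| ≤
      2 * s ^ 2 * k * 16 ^ k * (N : ℝ) ^ (-2 * (k : ℝ) - 1 / 4) := by
    refine (abs_inv_max_sub_inv_max_le hτ0 (gramDet_nonneg _ _) (gramDet_nonneg _ _)).trans ?_
    rw [div_le_iff₀ (by positivity), hτ3, mul_assoc _ ((N : ℝ) ^ _), ← Real.rpow_add hN0]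
    refine (hD.trans_eq hDN).trans_eq ?_
    congr 2; ring
  have hnu : ‖u'‖ ≤ s * U := norm_le_of_abs_apply_le hs hu'
  have hnv : ‖v'‖ ≤ s * U := norm_le_of_abs_apply_le hs hv'
  have hZ1 : 1 ≤ Z := (le_max_left _ _).trans (le_max_left _ _)
  have hmain : |κ - c * (max (√(gramDet u' v')) τ)⁻¹| ≤
      8 * s ^ 2 * 4 ^ k * (N : ℝ) ^ (-2 * (k : ℝ) - 1 / 4) +
        3 * (s * 2 ^ k) ^ 2 * ((N : ℝ) ^ ((k : ℝ) - 1 / 8) * Z ^ (-(3 / 2) : ℝ)) := by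
    rcases le_or_gt τ (√(gramDet u' v')) with h | h
    · have hpos : 0 < gramDet u' v' := Real.sqrt_pos.1 (hτ0.trans_le h)
      rw [max_eq_left h, ← div_eq_mul_inv]
      refine (hκ2 hpos).trans (le_add_of_le_of_nonneg ?_ (by positivity))
      calc _ ≤ 4 * ((s * U) ^ 2 + (s * U) ^ 2) / τ ^ 3 := by gcongr
        _ = 8 * s ^ 2 * 4 ^ k * ((N : ℝ) ^ (2 * (k : ℝ)) / τ ^ 3) := by
            have h1 : (N : ℝ) ^ (2 * (k : ℝ)) = ((N : ℝ) ^ (k : ℝ)) ^ 2 := by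
              rw [mul_comm, Real.rpow_mul hN0.le]; norm_cast
            have h2 : (4 : ℝ) ^ k = (2 ^ k) ^ 2 := by rw [← pow_mul, mul_comm, pow_mul]; norm_num
            rw [hUN, h1, h2]; ring
        _ ≤ _ := by
            rw [hτ3, ← Real.rpow_sub hN0]
            refine mul_le_mul_of_nonneg_left
              (Real.rpow_le_rpow_of_exponent_le hN' (by linarith)) (by positivity)
    · rw [max_eq_right h.le]
      refine le_add_of_nonneg_of_le (by positivity) ?_
      have hC1 : (1 : ℝ) ≤ s * 2 ^ k := by
        have : (1 : ℝ) ≤ 2 ^ k := one_le_pow₀ (by norm_num)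
        nlinarith
      have hUτ : s * U ≤ s * 2 ^ k * τ := by
        rw [hUN, ← mul_assoc]
        exact mul_le_mul_of_nonneg_left
          (Real.rpow_le_rpow_of_exponent_le hN' (by linarith)) (by positivity)
      have hτ1 : 1 ≤ τ := Real.one_le_rpow hN' (by linarith)
      have hZτ : Z ≤ s * 2 ^ k * τ :=
        max_le (max_le (one_le_mul_of_one_le_of_one_le hC1 hτ1) (hnu.trans hUτ))
          (max_le (hnv.trans hUτ) (h.le.trans (le_mul_of_one_le_left hτ0.le hC1)))
      have hZ0 : 0 < Z := by linarith
      have h1 : |κ - c * τ⁻¹| ≤ 3 * (s * 2 ^ k) * Z⁻¹ := by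
        have h2 : τ⁻¹ ≤ s * 2 ^ k * Z⁻¹ := by
          rw [← div_eq_mul_inv, le_div_iff₀ hZ0, ← div_eq_inv_mul, div_le_iff₀ hτ0]
          exact hZτ
        have h3 : κ ≤ 2 * (s * 2 ^ k) * Z⁻¹ := by
          rw [div_eq_mul_inv] at hκ1
          refine hκ1.trans ?_
          gcongr; linarith
        have h4 : c * τ⁻¹ ≤ s * 2 ^ k * Z⁻¹ :=
          (mul_le_of_le_one_left (by positivity) hc1).trans h2
        have h5 : 0 ≤ c * τ⁻¹ := by positivity
        rw [abs_le]; constructor <;> linarith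
      have h6 : Z⁻¹ ≤ (s * 2 ^ k) * ((N : ℝ) ^ ((k : ℝ) - 1 / 8) * Z ^ (-(3 / 2) : ℝ)) := by
        have h7 : Z⁻¹ = Z ^ (1 / 2 : ℝ) * Z ^ (-(3 / 2) : ℝ) := by
          rw [← Real.rpow_add hZ0, ← Real.rpow_neg_one]; norm_num
        have h8 : (N : ℝ) ^ ((k : ℝ) - 1 / 8) = τ ^ (1 / 2 : ℝ) := by
          rw [hτ, ← Real.rpow_mul hN0.le]; congr 1; ring
        rw [h7, h8, ← mul_assoc]
        gcongr
        calc Z ^ (1 / 2 : ℝ) ≤ (s * 2 ^ k * τ) ^ (1 / 2 : ℝ) := by gcongr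
          _ = (s * 2 ^ k) ^ (1 / 2 : ℝ) * τ ^ (1 / 2 : ℝ) :=
              Real.mul_rpow (by positivity) hτ0.le
          _ ≤ _ := by
              gcongr
              calc _ ≤ ((s : ℝ) * 2 ^ k) ^ (1 : ℝ) :=
                    Real.rpow_le_rpow_of_exponent_le hC1 (by norm_num)
                _ = _ := Real.rpow_one _
      calc _ ≤ 3 * (s * 2 ^ k) * Z⁻¹ := h1
        _ ≤ 3 * (s * 2 ^ k) *
            ((s * 2 ^ k) * ((N : ℝ) ^ ((k : ℝ) - 1 / 8) * Z ^ (-(3 / 2) : ℝ))) := by gcongr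
        _ = _ := by ring
  have htri : |κ - c * (max (√(gramDet u v)) τ)⁻¹| ≤ |κ - c * (max (√(gramDet u' v')) τ)⁻¹| +
      |(max (√(gramDet u' v')) τ)⁻¹ - (max (√(gramDet u v)) τ)⁻¹| := by
    calc _ = |(κ - c * (max (√(gramDet u' v')) τ)⁻¹) +
          c * ((max (√(gramDet u' v')) τ)⁻¹ - (max (√(gramDet u v)) τ)⁻¹)| := by congr 1; ring
      _ ≤ _ := by
          refine (abs_add_le _ _).trans (add_le_add le_rfl ?_)
          rw [abs_mul, abs_of_nonneg hc0]
          exact mul_le_of_le_one_left (abs_nonneg _) hc1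
  refine htri.trans ((add_le_add hmain hφ).trans ?_)
  have e1 : 0 ≤ (N : ℝ) ^ (-2 * (k : ℝ) - 1 / 4) := by positivity
  have e2 : 0 ≤ (N : ℝ) ^ ((k : ℝ) - 1 / 8) * Z ^ (-(3 / 2) : ℝ) := by positivity
  have c1 : (0 : ℝ) ≤ 2 * s ^ 2 * k * 16 ^ k := by positivity
  have c2 : (0 : ℝ) ≤ 8 * s ^ 2 * 4 ^ k := by positivity
  have c3 : (0 : ℝ) ≤ 3 * (s * 2 ^ k) ^ 2 := by positivity
  nlinarith [mul_nonneg c3 e1, mul_nonneg c1 e2, mul_nonneg c2 e2]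

end

/-- The tent function `W_η`. -/
noncomputable def tent (η c : ℝ) : ℝ := max 0 (1 - |c| / η)

lemma continuous_tent (η : ℝ) : Continuous (tent η) := by unfold tent; fun_prop

lemma tent_nonneg (η c : ℝ) : 0 ≤ tent η c := le_max_left _ _

lemma tent_le_one {η : ℝ} (hη : 0 < η) (c : ℝ) : tent η c ≤ 1 :=
  max_le zero_le_one (by have : 0 ≤ |c| / η := by positivity
                         linarith)

lemma tent_eq_zero {η c : ℝ} (hη : 0 < η) (h : η ≤ |c|) : tent η c = 0 :=
  max_eq_left (by rw [sub_nonpos, le_div_iff₀ hη]; linarith)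

lemma tent_eq {η c : ℝ} (hη : 0 < η) (h : |c| ≤ η) : tent η c = 1 - |c| / η :=
  max_eq_right (by rw [sub_nonneg, div_le_one hη]; exact h)

lemma hasCompactSupport_tent {η : ℝ} (hη : 0 < η) : HasCompactSupport (tent η) :=
  HasCompactSupport.of_support_subset_isCompact (isCompact_Icc (a := -η) (b := η)) fun c hc ↦ by
    by_contra h
    exact hc (tent_eq_zero hη (le_of_lt (by rwa [Set.mem_Icc, ← abs_le, not_le] at h)))

lemma integrable_tent {η : ℝ} (hη : 0 < η) : Integrable (tent η) :=
  (continuous_tent η).integrable_of_hasCompactSupport (hasCompactSupport_tent hη)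

lemma integral_tent_mul {η : ℝ} (hη : 0 < η) (g : ℝ → ℝ) (hg : ∀ t, g (-t) = g t) :
    ∫ t, tent η t * g t = 2 * ∫ t in (0 : ℝ)..η, (1 - t / η) * g t := by
  have h1 : ∫ t, tent η t * g t = ∫ t, (fun t ↦ tent η t * g t) |t| := by
    congr 1; ext t
    have h2 : tent η |t| = tent η t := by simp [tent]
    have h3 : g |t| = g t := by rcases abs_choice t with h | h <;> rw [h]; exact hg t
    simp only [h2, h3]
  rw [h1, integral_comp_abs (f := fun t ↦ tent η t * g t), intervalIntegral.integral_of_le hη.le]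
  congr 1
  rw [setIntegral_eq_of_subset_of_forall_sdiff_eq_zero (s := Set.Ioc 0 η) measurableSet_Ioi
    (fun t ht ↦ ht.1)]
  · refine setIntegral_congr_fun measurableSet_Ioc fun t ht ↦ ?_
    rw [tent_eq hη (by rw [abs_of_pos ht.1]; exact ht.2), abs_of_pos ht.1]
  · intro t ht
    have : η < t := by
      by_contra h
      exact ht.2 ⟨ht.1, not_lt.1 h⟩
    rw [tent_eq_zero hη (by rw [abs_of_pos (show 0 < t from ht.1)]; exact this.le), zero_mul]

lemma integral_tent {η : ℝ} (hη : 0 < η) : ∫ t, tent η t = η := by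
  have h := integral_tent_mul hη (fun _ ↦ 1) (fun _ ↦ rfl)
  simp only [mul_one] at h
  rw [h, intervalIntegral.integral_sub (by simp) (by apply Continuous.intervalIntegrable; fun_prop),
    intervalIntegral.integral_div]
  simp
  field_simp; ring

lemma integral_tent_affine {η q : ℝ} (hη : 0 < η) (hq : 0 < q) (c : ℝ) :
    ∫ t, tent η (c + q * t) = η / q := by
  rw [Measure.integral_comp_mul_left (fun t ↦ tent η (c + t)) q,
    integral_add_left_eq_self (tent η) c, integral_tent hη, abs_of_pos (by positivity),
    smul_eq_mul]
  field_simp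

section
open ProbabilityTheory

variable {E : Type*} [NormedAddCommGroup E] [InnerProductSpace ℝ E] [FiniteDimensional ℝ E]
  [MeasurableSpace E]

/-- The pair correlation of `W_η` along two directions under the standard Gaussian measure. -/
noncomputable def tentCorr (η : ℝ) (u v : E) : ℝ :=
  ∫ x, tent η (inner ℝ u x) * tent η (inner ℝ v x) ∂stdGaussian E

lemma tentCorr_nonneg (η : ℝ) (u v : E) : 0 ≤ tentCorr η u v :=
  integral_nonneg fun _ ↦ mul_nonneg (tent_nonneg _ _) (tent_nonneg _ _)

lemma tentCorr_comm (η : ℝ) (u v : E) : tentCorr η u v = tentCorr η v u := by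
  simp only [tentCorr, mul_comm]

variable [BorelSpace E]

lemma stdGaussian_map_inner {e : E} (he : ‖e‖ = 1) :
    (stdGaussian E).map (fun x ↦ inner ℝ e x) = gaussianReal 0 1 := by
  have h := IsGaussian.map_eq_gaussianReal (μ := stdGaussian E) (innerSL ℝ e)
  rw [integral_strongDual_stdGaussian, variance_dual_stdGaussian, innerSL_apply_norm, he] at h
  simpa using h

lemma stdGaussian_map_inner_prod {e₁ e₂ : E} (h₁ : ‖e₁‖ = 1) (h₂ : ‖e₂‖ = 1)
    (h₁₂ : inner ℝ e₁ e₂ = 0) :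
    (stdGaussian E).map (fun x ↦ (inner ℝ e₁ x, inner ℝ e₂ x)) =
      (gaussianReal 0 1).prod (gaussianReal 0 1) := by
  have hG : HasGaussianLaw (fun x : E ↦ (inner ℝ e₁ x, inner ℝ e₂ x)) (stdGaussian E) := by
    have := (IsGaussian.hasGaussianLaw_id (μ := stdGaussian E)).map
      ((innerSL ℝ e₁).prod (innerSL ℝ e₂))
    exact this
  have hc : cov[fun x ↦ inner ℝ e₁ x, fun x ↦ inner ℝ e₂ x; stdGaussian E] = 0 := by
    rw [← covarianceBilin_apply_eq_cov IsGaussian.memLp_two_id, covarianceBilin_stdGaussian]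
    exact h₁₂
  have := (indepFun_iff_map_prod_eq_prod_map_map (by fun_prop) (by fun_prop)).1
    (hG.indepFun_of_covariance_eq_zero hc)
  rw [this, stdGaussian_map_inner h₁, stdGaussian_map_inner h₂]

lemma integrable_of_continuous_of_le_one {X : Type*} [TopologicalSpace X] [MeasurableSpace X]
    [OpensMeasurableSpace X] {f : X → ℝ} (hf : Continuous f)
    {μ : Measure X} [IsFiniteMeasure μ] (h0 : ∀ x, 0 ≤ f x) (h1 : ∀ x, f x ≤ 1) :
    Integrable f μ :=
  Integrable.of_bound hf.measurable.aestronglyMeasurable 1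
    (Filter.Eventually.of_forall fun x ↦ by rw [Real.norm_of_nonneg (h0 x)]; exact h1 x)

lemma integrable_tent_inner {η : ℝ} (hη : 0 < η) (u : E) :
    Integrable (fun x ↦ tent η (inner ℝ u x)) (stdGaussian E) :=
  integrable_of_continuous_of_le_one ((continuous_tent η).comp (by fun_prop))
    (fun _ ↦ tent_nonneg _ _) (fun _ ↦ tent_le_one hη _)

lemma integrable_tent_inner_mul {η : ℝ} (hη : 0 < η) (u v : E) :
    Integrable (fun x ↦ tent η (inner ℝ u x) * tent η (inner ℝ v x)) (stdGaussian E) :=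
  integrable_of_continuous_of_le_one
    (((continuous_tent η).comp (by fun_prop)).mul ((continuous_tent η).comp (by fun_prop)))
    (fun _ ↦ mul_nonneg (tent_nonneg _ _) (tent_nonneg _ _))
    (fun _ ↦ mul_le_one₀ (tent_le_one hη _) (tent_nonneg _ _) (tent_le_one hη _))

lemma tentCorr_le_one {η : ℝ} (hη : 0 < η) (u v : E) : tentCorr η u v ≤ 1 := by
  calc tentCorr η u v ≤ ∫ _x, (1 : ℝ) ∂stdGaussian E :=
        integral_mono (integrable_tent_inner_mul hη u v) (integrable_const _)
          fun _ ↦ mul_le_one₀ (tent_le_one hη _) (tent_nonneg _ _) (tent_le_one hη _)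
    _ = 1 := by simp

lemma gaussianPDFReal_zero_one (a : ℝ) :
    gaussianPDFReal 0 1 a = (√(2 * Real.pi))⁻¹ * Real.exp (-a ^ 2 / 2) := by
  simp [gaussianPDFReal]

lemma gaussianPDFReal_le (a : ℝ) : gaussianPDFReal 0 1 a ≤ (√(2 * Real.pi))⁻¹ := by
  rw [gaussianPDFReal_zero_one]
  refine mul_le_of_le_one_right (by positivity) (Real.exp_le_one_iff.2 ?_)
  nlinarith [sq_nonneg a]

lemma tentCorr_le_div_norm {η : ℝ} (hη : 0 < η) (hη2 : η ≤ 2) {u : E} (hu : u ≠ 0) (v : E) :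
    tentCorr η u v ≤ 2 / ‖u‖ := by
  have hr : 0 < ‖u‖ := norm_pos_iff.2 hu
  have he : ‖(‖u‖⁻¹ • u : E)‖ = 1 := by rw [norm_smul]; simp [hr.ne']
  have hpi : (√(2 * Real.pi))⁻¹ ≤ 1 :=
    inv_le_one_of_one_le₀ (Real.one_le_sqrt.2 (by linarith [Real.two_le_pi]))
  calc tentCorr η u v ≤ ∫ x, tent η (inner ℝ u x) ∂stdGaussian E :=
        integral_mono (integrable_tent_inner_mul hη u v) (integrable_tent_inner hη u)
          fun _ ↦ mul_le_of_le_one_right (tent_nonneg _ _) (tent_le_one hη _)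
    _ = ∫ x, (fun a ↦ tent η (0 + ‖u‖ * a)) (inner ℝ (‖u‖⁻¹ • u) x) ∂stdGaussian E := by
        congr 1; ext x
        rw [real_inner_smul_left]
        simp only [zero_add]
        rw [mul_inv_cancel_left₀ hr.ne']
    _ = ∫ a, tent η (0 + ‖u‖ * a) ∂gaussianReal 0 1 := by
        rw [← stdGaussian_map_inner he,
          integral_map (f := fun a ↦ tent η (0 + ‖u‖ * a)) (by fun_prop)
          ((continuous_tent η).comp (by fun_prop)).aestronglyMeasurable]
    _ = ∫ a, gaussianPDFReal 0 1 a • tent η (0 + ‖u‖ * a) :=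
        integral_gaussianReal_eq_integral_smul one_ne_zero
    _ ≤ ∫ a, tent η (0 + ‖u‖ * a) := by
        refine integral_mono_of_nonneg (Filter.Eventually.of_forall fun a ↦
          mul_nonneg (gaussianPDFReal_nonneg _ _ _) (tent_nonneg _ _)) ?_
          (Filter.Eventually.of_forall fun a ↦
            mul_le_of_le_one_left (tent_nonneg _ _) ((gaussianPDFReal_le a).trans hpi))
        simp only [zero_add]
        exact (integrable_comp_mul_left_iff (tent η) hr.ne').2 (integrable_tent hη)
    _ = η / ‖u‖ := integral_tent_affine hη hr 0
    _ ≤ _ := by gcongr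

lemma tentCorr_eq_integral_prod {η : ℝ} (hη : 0 < η) {e₁ e₂ : E} (h₁ : ‖e₁‖ = 1)
    (h₂ : ‖e₂‖ = 1) (h₁₂ : inner ℝ e₁ e₂ = 0) {r p q : ℝ} (hr : 0 < r) (hq : 0 < q) :
    Integrable (fun z : ℝ × ℝ ↦ tent η (0 + r * z.1) * tent η (p * z.1 + q * z.2)) ∧
    ∫ z : ℝ × ℝ, tent η (0 + r * z.1) * tent η (p * z.1 + q * z.2) = η ^ 2 / (r * q) ∧
    tentCorr η (r • e₁) (p • e₁ + q • e₂) = ∫ z : ℝ × ℝ,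
      gaussianPDFReal 0 1 z.1 * gaussianPDFReal 0 1 z.2 *
        (tent η (0 + r * z.1) * tent η (p * z.1 + q * z.2)) := by
  set G : ℝ × ℝ → ℝ := fun z ↦ tent η (0 + r * z.1) * tent η (p * z.1 + q * z.2) with hG
  have hGc : Continuous G :=
    ((continuous_tent η).comp (by fun_prop)).mul ((continuous_tent η).comp (by fun_prop))
  have hGi : Integrable G := by
    refine hGc.integrable_of_hasCompactSupport
      (HasCompactSupport.of_support_subset_isCompact (K := Set.Icc (-(η / r)) (η / r) ×ˢ
        Set.Icc (-((η + |p| * (η / r)) / q)) ((η + |p| * (η / r)) / q))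
        (isCompact_Icc.prod isCompact_Icc) fun z hz ↦ ?_)
    have hz1 : |r * z.1| ≤ η := by
      by_contra h
      exact hz (by simp only [hG, zero_add]; rw [tent_eq_zero hη (not_le.1 h).le, zero_mul])
    have hz2 : |p * z.1 + q * z.2| ≤ η := by
      by_contra h
      exact hz (by simp only [hG]; rw [tent_eq_zero hη (not_le.1 h).le, mul_zero])
    have hz1' : |z.1| ≤ η / r := by
      rw [le_div_iff₀ hr]; rw [abs_mul, abs_of_pos hr] at hz1; linarith
    refine ⟨Set.mem_Icc.2 (abs_le.1 hz1'), Set.mem_Icc.2 (abs_le.1 ?_)⟩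
    rw [le_div_iff₀ hq, mul_comm, ← abs_of_pos hq, ← abs_mul]
    calc |q * z.2| = |(p * z.1 + q * z.2) - p * z.1| := by congr 1; ring
      _ ≤ |p * z.1 + q * z.2| + |p * z.1| := abs_sub _ _
      _ ≤ _ := by rw [abs_mul p]; gcongr
  refine ⟨hGi, ?_, ?_⟩
  · rw [Measure.volume_eq_prod, integral_prod _ (by rwa [← Measure.volume_eq_prod])]
    simp only [integral_const_mul, integral_tent_affine hη hq, integral_mul_const,
      integral_tent_affine hη hr]
    field_simp
  · have hgi : Integrable fun z : ℝ × ℝ ↦ gaussianPDFReal 0 1 z.1 * gaussianPDFReal 0 1 z.2 * G z := by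
      refine Integrable.bdd_mul (c := (√(2 * Real.pi))⁻¹ * (√(2 * Real.pi))⁻¹) hGi
        (by fun_prop) (Filter.Eventually.of_forall fun z ↦ ?_)
      rw [norm_mul, Real.norm_of_nonneg (gaussianPDFReal_nonneg _ _ _),
        Real.norm_of_nonneg (gaussianPDFReal_nonneg _ _ _)]
      exact mul_le_mul (gaussianPDFReal_le _) (gaussianPDFReal_le _)
        (gaussianPDFReal_nonneg _ _ _) (by positivity)
    have hG1 : Integrable G ((gaussianReal 0 1).prod (gaussianReal 0 1)) :=
      integrable_of_continuous_of_le_one hGc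
        (fun _ ↦ mul_nonneg (tent_nonneg _ _) (tent_nonneg _ _))
        (fun _ ↦ mul_le_one₀ (tent_le_one hη _) (tent_nonneg _ _) (tent_le_one hη _))
    calc _ = ∫ x, G (inner ℝ e₁ x, inner ℝ e₂ x) ∂stdGaussian E := by
          simp [tentCorr, hG, inner_add_left, real_inner_smul_left]
      _ = ∫ z, G z ∂((gaussianReal 0 1).prod (gaussianReal 0 1)) := by
          rw [← stdGaussian_map_inner_prod h₁ h₂ h₁₂,
            integral_map (by fun_prop) hGc.aestronglyMeasurable]
      _ = ∫ a, gaussianPDFReal 0 1 a * ∫ b, gaussianPDFReal 0 1 b * G (a, b) := by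
          rw [integral_prod _ hG1, integral_gaussianReal_eq_integral_smul one_ne_zero]
          simp only [integral_gaussianReal_eq_integral_smul one_ne_zero, smul_eq_mul]
      _ = _ := by
          rw [Measure.volume_eq_prod, integral_prod _ (by rwa [← Measure.volume_eq_prod])]
          simp only [← integral_const_mul, mul_assoc]
          rfl

end

section
open ProbabilityTheory

lemma tentCorr_bounds_of_orthonormal {E : Type*} [NormedAddCommGroup E] [InnerProductSpace ℝ E]
    [FiniteDimensional ℝ E] [MeasurableSpace E] [BorelSpace E] {η : ℝ} (hη : 0 < η)
    {e₁ e₂ : E} (h₁ : ‖e₁‖ = 1) (h₂ : ‖e₂‖ = 1) (h₁₂ : inner ℝ e₁ e₂ = 0) {r p q : ℝ}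
    (hr : 0 < r) (hq : 0 < q) :
    tentCorr η (r • e₁) (p • e₁ + q • e₂) ≤ η ^ 2 / (2 * Real.pi) / (r * q) ∧
    η ^ 2 / (2 * Real.pi) / (r * q) * (1 - η ^ 2 * (r ^ 2 + p ^ 2 + q ^ 2) / (r * q) ^ 2) ≤
      tentCorr η (r • e₁) (p • e₁ + q • e₂) := by
  obtain ⟨hi, hint, hK⟩ := tentCorr_eq_integral_prod hη h₁ h₂ h₁₂ (p := p) hr hq
  have hpi := Real.pi_pos
  have hsq : (√(2 * Real.pi))⁻¹ * (√(2 * Real.pi))⁻¹ = (2 * Real.pi)⁻¹ := by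
    rw [← mul_inv, Real.mul_self_sqrt (by positivity)]
  have hgi : Integrable fun z : ℝ × ℝ ↦ gaussianPDFReal 0 1 z.1 * gaussianPDFReal 0 1 z.2 *
      (tent η (0 + r * z.1) * tent η (p * z.1 + q * z.2)) := by
    refine Integrable.bdd_mul (c := (√(2 * Real.pi))⁻¹ * (√(2 * Real.pi))⁻¹) hi
      (by fun_prop) (Filter.Eventually.of_forall fun z ↦ ?_)
    rw [norm_mul, Real.norm_of_nonneg (gaussianPDFReal_nonneg _ _ _),
      Real.norm_of_nonneg (gaussianPDFReal_nonneg _ _ _)]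
    exact mul_le_mul (gaussianPDFReal_le _) (gaussianPDFReal_le _)
      (gaussianPDFReal_nonneg _ _ _) (by positivity)
  have hG0 : ∀ z : ℝ × ℝ, 0 ≤ tent η (0 + r * z.1) * tent η (p * z.1 + q * z.2) := fun z ↦
    mul_nonneg (tent_nonneg _ _) (tent_nonneg _ _)
  rw [hK]
  constructor
  · calc _ ≤ ∫ z : ℝ × ℝ, (2 * Real.pi)⁻¹ *
          (tent η (0 + r * z.1) * tent η (p * z.1 + q * z.2)) := by
          refine integral_mono hgi (hi.const_mul _) fun z ↦
            mul_le_mul_of_nonneg_right ?_ (hG0 z)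
          rw [← hsq]
          exact mul_le_mul (gaussianPDFReal_le _) (gaussianPDFReal_le _)
            (gaussianPDFReal_nonneg _ _ _) (by positivity)
      _ = _ := by rw [integral_const_mul, hint]; field_simp
  · set δ := η ^ 2 * (r ^ 2 + p ^ 2 + q ^ 2) / (r * q) ^ 2 with hδ
    calc _ = ∫ z : ℝ × ℝ, ((2 * Real.pi)⁻¹ * (1 - δ)) *
          (tent η (0 + r * z.1) * tent η (p * z.1 + q * z.2)) := by
          rw [integral_const_mul, hint]; field_simp
      _ ≤ _ := by
          refine integral_mono (hi.const_mul _) hgi fun z ↦ ?_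
          obtain ⟨a, b⟩ := z
          simp only [zero_add]
          rcases le_or_gt η |r * a| with h | hA
          · rw [tent_eq_zero hη h]; simp
          rcases le_or_gt η |p * a + q * b| with h | hB
          · rw [tent_eq_zero hη h]; simp
          refine mul_le_mul_of_nonneg_right ?_ (mul_nonneg (tent_nonneg _ _) (tent_nonneg _ _))
          have hA2 : (r * a) ^ 2 ≤ η ^ 2 := by
            rw [← sq_abs]; exact pow_le_pow_left₀ (abs_nonneg _) hA.le 2
          have hB2 : (p * a + q * b) ^ 2 ≤ η ^ 2 := by
            rw [← sq_abs]; exact pow_le_pow_left₀ (abs_nonneg _) hB.le 2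
          have hab : (a ^ 2 + b ^ 2) / 2 ≤ δ := by
            rw [hδ, div_le_div_iff₀ (by norm_num) (by positivity)]
            have e1 : (a ^ 2 + b ^ 2) * (r * q) ^ 2 =
              q ^ 2 * (r * a) ^ 2 + (r * (p * a + q * b) - p * (r * a)) ^ 2 := by ring
            have e2 : (r * (p * a + q * b) - p * (r * a)) ^ 2 ≤
              2 * (r ^ 2 * (p * a + q * b) ^ 2) + 2 * (p ^ 2 * (r * a) ^ 2) := by
              nlinarith [sq_nonneg (r * (p * a + q * b) + p * (r * a))]
            rw [e1]
            have e3 := mul_le_mul_of_nonneg_left hA2 (sq_nonneg q)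
            have e4 := mul_le_mul_of_nonneg_left hB2 (sq_nonneg r)
            have e5 := mul_le_mul_of_nonneg_left hA2 (sq_nonneg p)
            nlinarith [mul_nonneg (sq_nonneg η) (sq_nonneg q)]
          have e6 : gaussianPDFReal 0 1 a * gaussianPDFReal 0 1 b =
              (2 * Real.pi)⁻¹ * Real.exp (-((a ^ 2 + b ^ 2) / 2)) := by
            rw [gaussianPDFReal_zero_one, gaussianPDFReal_zero_one, ← hsq,
              show -((a ^ 2 + b ^ 2) / 2) = -a ^ 2 / 2 + -b ^ 2 / 2 by ring, Real.exp_add]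
            ring
          rw [e6]
          refine mul_le_mul_of_nonneg_left ?_ (by positivity)
          linarith [Real.add_one_le_exp (-((a ^ 2 + b ^ 2) / 2))]

lemma exists_orthonormal_decomp {s : ℕ} {u v : EuclideanSpace ℝ (Fin s)} (h : 0 < gramDet u v) :
    ∃ e₁ e₂ : EuclideanSpace ℝ (Fin s), ∃ r p q : ℝ, ‖e₁‖ = 1 ∧ ‖e₂‖ = 1 ∧ inner ℝ e₁ e₂ = 0 ∧
      0 < r ∧ 0 < q ∧ u = r • e₁ ∧ v = p • e₁ + q • e₂ ∧ r * q = √(gramDet u v) ∧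
      r ^ 2 + p ^ 2 + q ^ 2 = ‖u‖ ^ 2 + ‖v‖ ^ 2 := by
  have hu : u ≠ 0 := by rintro rfl; simp [gramDet] at h
  have hr : 0 < ‖u‖ := norm_pos_iff.2 hu
  set r := ‖u‖ with hrdef
  set e₁ := r⁻¹ • u with he₁
  have n1 : ‖e₁‖ = 1 := by rw [he₁, norm_smul, norm_inv, hrdef, norm_norm, inv_mul_cancel₀ (hrdef ▸ hr.ne')]
  have i11 : inner ℝ e₁ e₁ = (1 : ℝ) := by rw [real_inner_self_eq_norm_sq, n1]; norm_num
  have hu1 : u = r • e₁ := by rw [he₁, smul_inv_smul₀ hr.ne']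
  set p := inner ℝ e₁ v with hp
  set w := v - p • e₁ with hw
  have i1w : inner ℝ e₁ w = 0 := by
    rw [hw, inner_sub_right, inner_smul_right, i11, ← hp]; ring
  have hv : v = p • e₁ + w := by rw [hw]; abel
  have nv : ‖v‖ ^ 2 = p ^ 2 + ‖w‖ ^ 2 := by
    rw [hv, norm_add_sq_real, inner_smul_left, i1w, norm_smul, n1]; simp
  have iuv : inner ℝ u v = r * p := by
    rw [hp]; conv_lhs => rw [hu1]
    rw [inner_smul_left]; simp
  have hD : gramDet u v = (r * ‖w‖) ^ 2 := by
    rw [gramDet, iuv, nv, ← hrdef]; ring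
  have hq : 0 < ‖w‖ := by
    rcases (norm_nonneg w).eq_or_lt with h0 | h0
    · rw [hD, ← h0] at h; simp at h
    · exact h0
  refine ⟨e₁, ‖w‖⁻¹ • w, r, p, ‖w‖, n1, ?_, ?_, hr, hq, hu1, ?_, ?_, ?_⟩
  · rw [norm_smul]; simp [hq.ne']
  · rw [inner_smul_right, i1w, mul_zero]
  · rw [smul_inv_smul₀ hq.ne', ← hv]
  · rw [hD, Real.sqrt_sq (by positivity)]
  · rw [nv]; ring

lemma tentCorr_le_inv_sqrt {s : ℕ} {η : ℝ} (hη : 0 < η) {u v : EuclideanSpace ℝ (Fin s)}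
    (h : 0 < gramDet u v) : tentCorr η u v ≤ η ^ 2 / (2 * Real.pi) / √(gramDet u v) := by
  obtain ⟨e₁, e₂, r, p, q, h1, h2, h12, hr, hq, hu, hv, hD, -⟩ := exists_orthonormal_decomp h
  rw [← hD, hu, hv]
  exact (tentCorr_bounds_of_orthonormal hη h1 h2 h12 hr hq).1

lemma sq_div_two_pi_le_one {η : ℝ} (hη : 0 < η) (hη2 : η ≤ 2) : η ^ 2 / (2 * Real.pi) ≤ 1 := by
  rw [div_le_one (by positivity)]
  nlinarith [Real.two_le_pi]

lemma abs_tentCorr_sub_le {s : ℕ} {η : ℝ} (hη : 0 < η) (hη2 : η ≤ 2)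
    {u v : EuclideanSpace ℝ (Fin s)} (h : 0 < gramDet u v) :
    |tentCorr η u v - η ^ 2 / (2 * Real.pi) / √(gramDet u v)| ≤
      4 * (‖u‖ ^ 2 + ‖v‖ ^ 2) / √(gramDet u v) ^ 3 := by
  obtain ⟨e₁, e₂, r, p, q, h1, h2, h12, hr, hq, hu, hv, hD, hn⟩ := exists_orthonormal_decomp h
  have hb := tentCorr_bounds_of_orthonormal hη h1 h2 h12 (p := p) hr hq
  rw [← hu, ← hv, hn, hD] at hb
  have hd : 0 < √(gramDet u v) := Real.sqrt_pos.2 h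
  rw [abs_of_nonpos (by linarith [hb.1])]
  have hη4 : η ^ 2 ≤ 4 := by nlinarith
  have e : η ^ 2 / (2 * Real.pi) / √(gramDet u v) *
      (η ^ 2 * (‖u‖ ^ 2 + ‖v‖ ^ 2) / √(gramDet u v) ^ 2) ≤
      4 * (‖u‖ ^ 2 + ‖v‖ ^ 2) / √(gramDet u v) ^ 3 := by
    calc _ ≤ 1 / √(gramDet u v) * (4 * (‖u‖ ^ 2 + ‖v‖ ^ 2) / √(gramDet u v) ^ 2) := by
          gcongr
          exact sq_div_two_pi_le_one hη hη2
      _ = _ := by field_simp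
  linarith [hb.2]

lemma tentCorr_le_two_div_gramSize {s : ℕ} {η : ℝ} (hη : 0 < η) (hη2 : η ≤ 2)
    (u v : EuclideanSpace ℝ (Fin s)) : tentCorr η u v ≤ 2 / gramSize u v := by
  have hg : ∀ x : ℝ, (0 < x → tentCorr η u v ≤ 2 / x) → 0 < gramSize u v → gramSize u v = x →
      tentCorr η u v ≤ 2 / gramSize u v := fun x h h0 hx ↦ by rw [hx] at h0 ⊢; exact h h0
  have h0 : 0 < gramSize u v :=
    lt_of_lt_of_le one_pos ((le_max_left _ _).trans (le_max_left _ _))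
  rcases max_choice (max 1 ‖u‖) (max ‖v‖ √(gramDet u v)) with h | h
  · rcases max_choice 1 ‖u‖ with h' | h'
    · exact hg 1 (fun _ ↦ by linarith [tentCorr_le_one hη u v]) h0 (by rw [gramSize, h, h'])
    · exact hg ‖u‖ (fun hx ↦ tentCorr_le_div_norm hη hη2 (norm_pos_iff.1 hx) v) h0
        (by rw [gramSize, h, h'])
  · rcases max_choice ‖v‖ √(gramDet u v) with h' | h'
    · exact hg ‖v‖ (fun hx ↦ by
        rw [tentCorr_comm]; exact tentCorr_le_div_norm hη hη2 (norm_pos_iff.1 hx) u) h0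
        (by rw [gramSize, h, h'])
    · refine hg √(gramDet u v) (fun hx ↦ (tentCorr_le_inv_sqrt hη (Real.sqrt_pos.1 hx)).trans ?_)
        h0 (by rw [gramSize, h, h'])
      gcongr
      linarith [sq_div_two_pi_le_one hη hη2]

end

section
open ProbabilityTheory

/-- The count of points of a translate of the integer cube, weighted by `W_η`. -/
noncomputable def shiftCount (k s N : ℕ) (η : ℝ) (l a : Fin s → ℝ) : ℝ :=
  ∑ x ∈ intCube s N, tent η (∑ j, l j * ((x j : ℝ) + a j) ^ k)

section
variable {k s N : ℕ} {η : ℝ}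

lemma continuous_shiftCount (k s N : ℕ) (η : ℝ) :
    Continuous fun z : (Fin s → ℝ) × (Fin s → ℝ) ↦ shiftCount k s N η z.1 z.2 := by
  unfold shiftCount
  exact continuous_finsetSum _ fun x _ ↦ (continuous_tent η).comp (by fun_prop)

lemma shiftCount_nonneg (l a : Fin s → ℝ) : 0 ≤ shiftCount k s N η l a :=
  Finset.sum_nonneg fun _ _ ↦ tent_nonneg _ _

lemma shiftCount_le_card (hη : 0 < η) (l a : Fin s → ℝ) :
    shiftCount k s N η l a ≤ (intCube s N).card := by
  unfold shiftCount
  calc _ ≤ ∑ x ∈ intCube s N, (1 : ℝ) := Finset.sum_le_sum fun _ _ ↦ tent_le_one hη _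
    _ = _ := by simp

lemma integral_tent_mul_tent (a b : Fin s → ℝ) (x y : Fin s → ℤ) :
    ∫ l : Fin s → ℝ, tent η (∑ j, l j * ((x j : ℝ) + a j) ^ k) *
      tent η (∑ j, l j * ((y j : ℝ) + b j) ^ k) ∂Measure.pi (fun _ ↦ gaussianReal 0 1) =
    tentCorr η (shiftPow k a x) (shiftPow k b y) := by
  have h : ∀ (a : Fin s → ℝ) (x : Fin s → ℤ) (l : Fin s → ℝ),
      ∑ j, l j * ((x j : ℝ) + a j) ^ k = inner ℝ (shiftPow k a x) (WithLp.toLp 2 l) := by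
    intro a x l
    simp [PiLp.inner_apply, shiftPow]
  simp only [h]
  rw [tentCorr, ← map_pi_eq_stdGaussian, integral_map (by fun_prop)]
  exact (((continuous_tent η).comp (by fun_prop)).mul
    ((continuous_tent η).comp (by fun_prop))).aestronglyMeasurable

lemma integral_shiftCount_mul (hη : 0 < η) (a b : Fin s → ℝ) :
    ∫ l, shiftCount k s N η l a * shiftCount k s N η l b
      ∂Measure.pi (fun _ : Fin s ↦ gaussianReal 0 1) =
    ∑ x ∈ intCube s N, ∑ y ∈ intCube s N, tentCorr η (shiftPow k a x) (shiftPow k b y) := by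
  simp only [shiftCount, Finset.sum_mul_sum, ← integral_tent_mul_tent]
  have hi : ∀ x y : Fin s → ℤ, Integrable (fun l : Fin s → ℝ ↦
      tent η (∑ j, l j * ((x j : ℝ) + a j) ^ k) * tent η (∑ j, l j * ((y j : ℝ) + b j) ^ k))
      (Measure.pi (fun _ ↦ gaussianReal 0 1)) := fun x y ↦
    integrable_of_continuous_of_le_one
      (((continuous_tent η).comp (by fun_prop)).mul ((continuous_tent η).comp (by fun_prop)))
      (fun _ ↦ mul_nonneg (tent_nonneg _ _) (tent_nonneg _ _))
      (fun _ ↦ mul_le_one₀ (tent_le_one hη _) (tent_nonneg _ _) (tent_le_one hη _))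
  rw [integral_finsetSum _ fun x _ ↦ integrable_finsetSum _ fun y _ ↦ hi x y]
  exact Finset.sum_congr rfl fun x _ ↦ integral_finsetSum _ fun y _ ↦ hi x y

lemma card_intCube_le (hN : 1 ≤ N) : ((intCube s N).card : ℝ) ≤ (3 * N) ^ s := by
  rw [intCube, Fintype.card_piFinset_const, Nat.cast_pow, Int.card_Icc]
  gcongr
  have : ((N : ℤ) + 1 - -(N : ℤ)).toNat = 2 * N + 1 := by omega
  rw [this]
  have : (1 : ℝ) ≤ N := by exact_mod_cast hN
  push_cast
  linarith

/-- The constant in the estimate for the pair correlations of translated cubes. -/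
noncomputable def corrConst (k s : ℕ) : ℝ :=
  (2 * s ^ 2 * k * 16 ^ k + 8 * s ^ 2 * 4 ^ k + 3 * (s * 2 ^ k) ^ 2) *
    (3 ^ (2 * s) + 3 * 48 ^ (2 * s))

/-- The leading term of the pair correlations. -/
noncomputable def corrMain (k s N : ℕ) (η : ℝ) : ℝ :=
  ∑ x ∈ intCube s N, ∑ y ∈ intCube s N, η ^ 2 / (2 * Real.pi) *
    (max (√(gramDet (shiftPow k 0 x) (shiftPow k 0 y))) ((N : ℝ) ^ (2 * (k : ℝ) - 1 / 4)))⁻¹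

lemma abs_integral_shiftCount_mul_sub_le (hk : 1 ≤ k) (hs : 2 * k < s) (hN : 1 ≤ N)
    (hη : 0 < η) (hη2 : η ≤ 2) {a b : Fin s → ℝ}
    (ha : ∀ j, |a j| ≤ 1 / 2) (hb : ∀ j, |b j| ≤ 1 / 2) :
    |(∫ l, shiftCount k s N η l a * shiftCount k s N η l b
      ∂Measure.pi (fun _ : Fin s ↦ gaussianReal 0 1)) - corrMain k s N η| ≤
    corrConst k s * (N : ℝ) ^ (2 * (s : ℝ) - 2 * k - 1 / 8) := by
  have hN' : (1 : ℝ) ≤ N := by exact_mod_cast hN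
  have hN0 : (0 : ℝ) < N := by positivity
  set K : ℝ := 2 * s ^ 2 * k * 16 ^ k + 8 * s ^ 2 * 4 ^ k + 3 * (s * 2 ^ k) ^ 2 with hK
  have hK0 : 0 ≤ K := by positivity
  rw [integral_shiftCount_mul hη, corrMain, ← Finset.sum_sub_distrib]
  simp only [← Finset.sum_sub_distrib]
  calc _ ≤ ∑ x ∈ intCube s N, ∑ y ∈ intCube s N, K * ((N : ℝ) ^ (-2 * (k : ℝ) - 1 / 4) +
        (N : ℝ) ^ ((k : ℝ) - 1 / 8) *
          gramSize (shiftPow k a x) (shiftPow k b y) ^ (-(3 / 2) : ℝ)) := by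
        refine (Finset.abs_sum_le_sum_abs _ _).trans (Finset.sum_le_sum fun x hx ↦
          (Finset.abs_sum_le_sum_abs _ _).trans (Finset.sum_le_sum fun y hy ↦ ?_))
        exact abs_sub_inv_max_le hk (by omega) hN ha hb hx hy (tentCorr_nonneg _ _ _)
          (by positivity) (sq_div_two_pi_le_one hη hη2)
          (tentCorr_le_two_div_gramSize hη hη2 _ _) (fun h ↦ abs_tentCorr_sub_le hη hη2 h)
    _ = K * (((intCube s N).card : ℝ) * (intCube s N).card * (N : ℝ) ^ (-2 * (k : ℝ) - 1 / 4) +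
        (N : ℝ) ^ ((k : ℝ) - 1 / 8) * ∑ x ∈ intCube s N, ∑ y ∈ intCube s N,
          gramSize (shiftPow k a x) (shiftPow k b y) ^ (-(3 / 2) : ℝ)) := by
        simp only [← Finset.mul_sum, Finset.sum_add_distrib, Finset.sum_const, nsmul_eq_mul]
        ring
    _ ≤ K * ((3 * N) ^ s * (3 * N) ^ s * (N : ℝ) ^ (-2 * (k : ℝ) - 1 / 4) +
        (N : ℝ) ^ ((k : ℝ) - 1 / 8) * (3 * 48 ^ (2 * s) * (N : ℝ) ^ (2 * (s : ℝ) - 3 * k))) := by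
        have := sum_gramSize_rpow_le (by omega) hs hN a b
        have := card_intCube_le (s := s) hN
        gcongr
    _ = K * (3 ^ (2 * s) * (N : ℝ) ^ (2 * (s : ℝ) - 2 * k - 1 / 4) +
          3 * 48 ^ (2 * s) * (N : ℝ) ^ (2 * (s : ℝ) - 2 * k - 1 / 8)) := by
        have e1 : (N : ℝ) ^ (2 * (s : ℝ) - 2 * k - 1 / 8) =
            (N : ℝ) ^ ((k : ℝ) - 1 / 8) * (N : ℝ) ^ (2 * (s : ℝ) - 3 * k) := by
          rw [← Real.rpow_add hN0]; congr 1; ring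
        have e2 : (N : ℝ) ^ (2 * (s : ℝ) - 2 * k - 1 / 4) =
            (N : ℝ) ^ (2 * s) * (N : ℝ) ^ (-2 * (k : ℝ) - 1 / 4) := by
          rw [← Real.rpow_natCast, ← Real.rpow_add hN0]; congr 1; push_cast; ring
        rw [e1, e2, mul_pow, two_mul s, pow_add, pow_add]
        ring
    _ ≤ K * (3 ^ (2 * s) * (N : ℝ) ^ (2 * (s : ℝ) - 2 * k - 1 / 8) +
          3 * 48 ^ (2 * s) * (N : ℝ) ^ (2 * (s : ℝ) - 2 * k - 1 / 8)) := by
        have : (N : ℝ) ^ (2 * (s : ℝ) - 2 * k - 1 / 4) ≤ (N : ℝ) ^ (2 * (s : ℝ) - 2 * k - 1 / 8) :=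
          Real.rpow_le_rpow_of_exponent_le hN' (by linarith)
        gcongr
    _ = _ := by rw [corrConst]; ring

lemma continuous_shiftCount_left (k N : ℕ) (η : ℝ) (a : Fin s → ℝ) :
    Continuous fun l ↦ shiftCount k s N η l a := by
  unfold shiftCount
  exact continuous_finsetSum _ fun x _ ↦ (continuous_tent η).comp (by fun_prop)

lemma continuous_shiftCount_right (k N : ℕ) (η : ℝ) (l : Fin s → ℝ) :
    Continuous fun a ↦ shiftCount k s N η l a := by
  unfold shiftCount
  exact continuous_finsetSum _ fun x _ ↦ (continuous_tent η).comp (by fun_prop)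

lemma integrable_shiftCount_mul {μ : Measure (Fin s → ℝ)} [IsFiniteMeasure μ] (hη : 0 < η)
    (a b : Fin s → ℝ) :
    Integrable (fun l ↦ shiftCount k s N η l a * shiftCount k s N η l b) μ := by
  have hc := ((continuous_shiftCount_left k N η a).mul (continuous_shiftCount_left k N η b))
  refine Integrable.of_bound (C := ((intCube s N).card * (intCube s N).card : ℝ))
    hc.measurable.aestronglyMeasurable (Filter.Eventually.of_forall fun l ↦ ?_)
  rw [Real.norm_of_nonneg (mul_nonneg (shiftCount_nonneg _ _) (shiftCount_nonneg _ _))]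
  exact mul_le_mul (shiftCount_le_card hη _ _) (shiftCount_le_card hη _ _)
    (shiftCount_nonneg _ _) (by positivity)

lemma integral_shiftCount_sub_sq_le (hk : 1 ≤ k) (hs : 2 * k < s) (hN : 1 ≤ N)
    (hη : 0 < η) (hη2 : η ≤ 2) {a b : Fin s → ℝ}
    (ha : ∀ j, |a j| ≤ 1 / 2) (hb : ∀ j, |b j| ≤ 1 / 2) :
    ∫ l, (shiftCount k s N η l a - shiftCount k s N η l b) ^ 2
      ∂Measure.pi (fun _ : Fin s ↦ gaussianReal 0 1) ≤
    4 * corrConst k s * (N : ℝ) ^ (2 * (s : ℝ) - 2 * k - 1 / 8) := by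
  have e : ∀ l, (shiftCount k s N η l a - shiftCount k s N η l b) ^ 2 =
      shiftCount k s N η l a * shiftCount k s N η l a -
      2 * (shiftCount k s N η l a * shiftCount k s N η l b) +
      shiftCount k s N η l b * shiftCount k s N η l b := fun l ↦ by ring
  simp only [e]
  have i1 := integrable_shiftCount_mul (k := k) (N := N)
    (μ := Measure.pi (fun _ : Fin s ↦ gaussianReal 0 1)) hη a a
  have i2 := (integrable_shiftCount_mul (k := k) (N := N)
    (μ := Measure.pi (fun _ : Fin s ↦ gaussianReal 0 1)) hη a b).const_mul 2
  have i3 := integrable_shiftCount_mul (k := k) (N := N)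
    (μ := Measure.pi (fun _ : Fin s ↦ gaussianReal 0 1)) hη b b
  have i4 : Integrable (fun l ↦ shiftCount k s N η l a * shiftCount k s N η l a -
      2 * (shiftCount k s N η l a * shiftCount k s N η l b))
      (Measure.pi (fun _ : Fin s ↦ gaussianReal 0 1)) := i1.sub i2
  rw [integral_add i4 i3, integral_sub i1 i2, integral_const_mul]
  have h1 := abs_le.1 (abs_integral_shiftCount_mul_sub_le hk hs hN hη hη2 ha ha)
  have h2 := abs_le.1 (abs_integral_shiftCount_mul_sub_le hk hs hN hη hη2 ha hb)
  have h3 := abs_le.1 (abs_integral_shiftCount_mul_sub_le hk hs hN hη hη2 hb hb)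
  linarith [h1.2, h2.1, h3.2]

end

end

section
open FourierTransform

lemma integral_tent_mul_cos {η c : ℝ} (hη : 0 < η) (hc : c ≠ 0) :
    ∫ t, tent η t * Real.cos (c * t) = η * (Real.sin (c * η / 2) / (c * η / 2)) ^ 2 := by
  rw [integral_tent_mul hη (fun t ↦ Real.cos (c * t)) (fun t ↦ by simp)]
  have hd : ∀ t ∈ Set.uIcc 0 η, HasDerivAt
      (fun t ↦ (1 - t / η) * (Real.sin (c * t) / c) - Real.cos (c * t) / (η * c ^ 2))
      ((1 - t / η) * Real.cos (c * t)) t := by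
    intro t _
    have h1 : HasDerivAt (fun t : ℝ ↦ c * t) c t := by simpa using (hasDerivAt_id t).const_mul c
    have h2 : HasDerivAt (fun t : ℝ ↦ 1 - t / η) (-(1 / η)) t := by
      simpa using ((hasDerivAt_id t).div_const η).const_sub 1
    refine ((h2.mul (h1.sin.div_const c)).sub (h1.cos.div_const (η * c ^ 2))).congr_deriv ?_
    field_simp
    ring
  rw [intervalIntegral.integral_eq_sub_of_hasDerivAt hd
    (by apply Continuous.intervalIntegrable; fun_prop)]
  have e : Real.cos (c * η) = 1 - 2 * Real.sin (c * η / 2) ^ 2 := by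
    rw [show c * η = 2 * (c * η / 2) by ring, Real.cos_two_mul, Real.cos_sq']
    ring_nf
  rw [e]
  simp
  field_simp
  ring

lemma fourier_tent {η : ℝ} (hη : 0 < η) {w : ℝ} (hw : w ≠ 0) :
    𝓕 (fun t ↦ (tent η t : ℂ)) w =
      ((η * (Real.sin (Real.pi * η * w) / (Real.pi * η * w)) ^ 2 : ℝ) : ℂ) := by
  have hi : ∀ g : ℝ → ℝ, Continuous g → (∀ t, |g t| ≤ 1) → Integrable fun t ↦ tent η t * g t := by
    intro g hg hb
    exact (integrable_tent hη).mul_bdd hg.aestronglyMeasurable (Filter.Eventually.of_forall hb)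
  have e1 : ∀ t, Complex.exp (((-2 * Real.pi * t * w : ℝ) : ℂ) * Complex.I) • (tent η t : ℂ) =
      ((tent η t * Real.cos (2 * Real.pi * w * t) : ℝ) : ℂ) +
        ((tent η t * Real.sin (-(2 * Real.pi * w * t)) : ℝ) : ℂ) * Complex.I := by
    intro t
    rw [Complex.exp_mul_I, ← Complex.ofReal_cos, ← Complex.ofReal_sin,
      show -2 * Real.pi * t * w = -(2 * Real.pi * w * t) by ring, Real.cos_neg]
    push_cast
    rw [smul_eq_mul]
    ring
  have i1 := hi (fun t ↦ Real.cos (2 * Real.pi * w * t)) (by fun_prop)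
    (fun t ↦ Real.abs_cos_le_one _)
  have i2 := hi (fun t ↦ Real.sin (-(2 * Real.pi * w * t))) (by fun_prop)
    (fun t ↦ Real.abs_sin_le_one _)
  have odd : ∫ t, tent η t * Real.sin (-(2 * Real.pi * w * t)) = 0 := by
    have h := integral_neg_eq_self (fun t ↦ tent η t * Real.sin (-(2 * Real.pi * w * t))) volume
    have h' : ∀ t, tent η (-t) * Real.sin (-(2 * Real.pi * w * -t)) =
        -(tent η t * Real.sin (-(2 * Real.pi * w * t))) := by
      intro t
      rw [mul_neg, Real.sin_neg (- _), show tent η (-t) = tent η t by simp [tent]]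
      ring
    simp only [h', integral_neg] at h
    linarith
  rw [Real.fourier_real_eq_integral_exp_smul]
  simp only [e1]
  rw [integral_add i1.ofReal (i2.ofReal.mul_const _), integral_mul_const, integral_complex_ofReal,
    integral_complex_ofReal, odd, integral_tent_mul_cos hη (by positivity)]
  simp only [Complex.ofReal_zero, zero_mul, add_zero]
  rw [show 2 * Real.pi * w * η / 2 = Real.pi * η * w by ring]

lemma sin_div_sq_le (x : ℝ) : (Real.sin x / x) ^ 2 ≤ 2 * (1 + x ^ 2)⁻¹ := by
  rcases eq_or_ne x 0 with rfl | hx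
  · simp
  have h1 : Real.sin x ^ 2 ≤ x ^ 2 := by
    rw [← sq_abs, ← sq_abs x]
    exact pow_le_pow_left₀ (abs_nonneg _) Real.abs_sin_le_abs 2
  rw [div_pow, ← div_eq_mul_inv, div_le_div_iff₀ (by positivity) (by positivity)]
  nlinarith [Real.sin_sq_le_one x, sq_nonneg x]

lemma integrable_fejer {η : ℝ} (hη : 0 < η) :
    Integrable fun w : ℝ ↦ η * (Real.sin (Real.pi * η * w) / (Real.pi * η * w)) ^ 2 := by
  refine Integrable.const_mul ?_ η
  have h : Integrable fun w : ℝ ↦ 2 * (1 + (Real.pi * η * w) ^ 2)⁻¹ :=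
    ((integrable_comp_mul_left_iff (fun x : ℝ ↦ (1 + x ^ 2)⁻¹)
      (by positivity : Real.pi * η ≠ 0)).2 integrable_inv_one_add_sq).const_mul 2
  refine h.mono' (by fun_prop : Measurable fun w : ℝ ↦
    (Real.sin (Real.pi * η * w) / (Real.pi * η * w)) ^ 2).aestronglyMeasurable (Filter.Eventually.of_forall fun w ↦ ?_)
  rw [Real.norm_of_nonneg (by positivity)]
  exact sin_div_sq_le _

lemma integral_dEta {η : ℝ} (hη : 0 < η) (g : ℝ → ℂ) :
    ∫ α, g α ∂dEta η =
      ∫ α, (η * (Real.sin (Real.pi * η * α) / (Real.pi * η * α)) ^ 2) • g α := by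
  rw [dEta, integral_withDensity_eq_integral_toReal_smul (by fun_prop) (by simp)]
  congr 1; ext α
  rw [ENNReal.toReal_ofReal (by positivity)]

lemma isFiniteMeasure_dEta {η : ℝ} (hη : 0 < η) : IsFiniteMeasure (dEta η) :=
  isFiniteMeasure_withDensity_ofReal (integrable_fejer hη).2

lemma integral_eF_dEta {η : ℝ} (hη : 0 < η) (c : ℝ) :
    ∫ α, eF (α * c) ∂dEta η = (tent η c : ℂ) := by
  have hae : (𝓕 (fun t ↦ (tent η t : ℂ))) =ᵐ[volume]
      fun w ↦ ((η * (Real.sin (Real.pi * η * w) / (Real.pi * η * w)) ^ 2 : ℝ) : ℂ) := by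
    filter_upwards [compl_mem_ae_iff.2 (measure_singleton (0 : ℝ))] with w hw
    exact fourier_tent hη hw
  have h := (Continuous.fourierInv_fourier_eq (f := fun t ↦ (tent η t : ℂ))
    (Complex.continuous_ofReal.comp (continuous_tent η)) (integrable_tent hη).ofReal
    ((integrable_fejer hη).ofReal.congr hae.symm))
  rw [integral_dEta hη, ← congrFun h c, Real.fourierInv_eq']
  refine integral_congr_ae ?_
  filter_upwards [hae] with w hw
  rw [hw, Complex.real_smul, smul_eq_mul, mul_comm, eF]
  congr 2
  simp
  ring

end

lemma continuous_eF : Continuous eF := by unfold eF; fun_prop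

lemma norm_eF (t : ℝ) : ‖eF t‖ = 1 := by
  rw [eF, show 2 * (Real.pi : ℂ) * Complex.I * t = ((2 * Real.pi * t : ℝ) : ℂ) * Complex.I by
    push_cast; ring]
  exact Complex.norm_exp_ofReal_mul_I _

lemma eF_sum {ι : Type*} (A : Finset ι) (f : ι → ℝ) : eF (∑ j ∈ A, f j) = ∏ j ∈ A, eF (f j) := by
  simp only [eF, ← Complex.exp_sum, Complex.ofReal_sum, Finset.mul_sum]

/-- Lebesgue measure on the unit cube centred at the origin. -/
noncomputable def unitCube (s : ℕ) : Measure (Fin s → ℝ) :=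
  Measure.pi fun _ ↦ volume.restrict (Set.Ioc (-(1 / 2)) (1 / 2))

instance (s : ℕ) : IsProbabilityMeasure (unitCube s) := by
  have : IsProbabilityMeasure ((volume : Measure ℝ).restrict (Set.Ioc (-(1 / 2)) (1 / 2))) :=
    ⟨by rw [Measure.restrict_apply_univ, Real.volume_Ioc]; norm_num⟩
  unfold unitCube
  infer_instance

lemma ae_unitCube (s : ℕ) : ∀ᵐ t ∂unitCube s, ∀ j, |t j| ≤ 1 / 2 := by
  rw [ae_all_iff]
  intro j
  refine Measure.tendsto_eval_ae_ae.eventually (p := fun x : ℝ ↦ |x| ≤ 1 / 2) ?_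
  filter_upwards [ae_restrict_mem measurableSet_Ioc] with x hx
  exact abs_le.2 ⟨hx.1.le, hx.2⟩

lemma vInt_eq_integral_sum (k N : ℕ) (α : ℝ) :
    vInt k (N + 1 / 2) α = ∫ t in Set.Ioc (-(1 / 2) : ℝ) (1 / 2),
      ∑ n ∈ Finset.Icc (-(N : ℤ)) N, eF (α * ((n : ℝ) + t) ^ k) := by
  set f : ℝ → ℂ := fun ξ ↦ eF (α * ξ ^ k) with hf
  have hfc : Continuous f := continuous_eF.comp (by fun_prop)
  have h := intervalIntegral.sum_integral_adjacent_intervals (f := f) (μ := volume)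
    (a := fun i : ℕ ↦ (i : ℝ) - N - 1 / 2) (n := 2 * N + 1)
    (fun i _ ↦ hfc.intervalIntegrable _ _)
  have hi : ∀ n ∈ Finset.Icc (-(N : ℤ)) N, IntervalIntegrable
      (fun t ↦ eF (α * ((n : ℝ) + t) ^ k)) volume (-(1 / 2)) (1 / 2) := fun n _ ↦
    (continuous_eF.comp (by fun_prop)).intervalIntegrable _ _
  rw [← intervalIntegral.integral_of_le (by norm_num), intervalIntegral.integral_finsetSum hi]
  have h0 : vInt k (N + 1 / 2) α =
      ∫ ξ in ((0 : ℕ) : ℝ) - N - 1 / 2..((2 * N + 1 : ℕ) : ℝ) - N - 1 / 2, f ξ := by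
    rw [vInt]; congr 1 <;> push_cast <;> ring
  rw [h0, ← h]
  refine Finset.sum_bij (fun i _ ↦ (i : ℤ) - N) (fun i hi ↦ ?_) (fun i _ j _ hij ↦ ?_)
    (fun n hn ↦ ?_) (fun i _ ↦ ?_)
  · simp only [Finset.mem_range, Finset.mem_Icc] at hi ⊢; omega
  · omega
  · rw [Finset.mem_Icc] at hn
    exact ⟨(n + N).toNat, by simp only [Finset.mem_range]; omega, by omega⟩
  · have := intervalIntegral.integral_comp_add_left f (((i : ℤ) - N : ℤ) : ℝ)
      (a := -(1 / 2)) (b := 1 / 2)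
    rw [hf] at this ⊢
    simp only at this
    rw [this]
    congr 1 <;> push_cast <;> ring

lemma prod_vInt_eq {k s : ℕ} (N : ℕ) (l : Fin s → ℝ) (α : ℝ) :
    ∏ j, vInt k (N + 1 / 2) (l j * α) =
      ∫ t, ∑ x ∈ intCube s N, eF (α * ∑ j, l j * ((x j : ℝ) + t j) ^ k) ∂unitCube s := by
  simp only [vInt_eq_integral_sum]
  rw [← integral_fintype_prod_eq_prod (𝕜 := ℂ) (fun (j : Fin s) (t : ℝ) ↦
    ∑ n ∈ Finset.Icc (-(N : ℤ)) N, eF (l j * α * ((n : ℝ) + t) ^ k))]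
  refine integral_congr_ae (Filter.Eventually.of_forall fun t ↦ ?_)
  simp only
  rw [Finset.prod_univ_sum, intCube]
  refine Finset.sum_congr rfl fun x _ ↦ ?_
  rw [Finset.mul_sum, eF_sum]
  exact Finset.prod_congr rfl fun j _ ↦ by congr 1; ring

lemma integral_prod_vInt_eq {k s : ℕ} (N : ℕ) {η : ℝ} (hη : 0 < η) (l : Fin s → ℝ) :
    ∫ α, ∏ j, vInt k (N + 1 / 2) (l j * α) ∂dEta η =
      ((∫ t, shiftCount k s N η l t ∂unitCube s : ℝ) : ℂ) := by
  have hfin := isFiniteMeasure_dEta hη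
  simp only [prod_vInt_eq]
  have hc : ∀ x : Fin s → ℤ, Continuous fun z : ℝ × (Fin s → ℝ) ↦
      eF (z.1 * ∑ j, l j * ((x j : ℝ) + z.2 j) ^ k) := fun x ↦ continuous_eF.comp (by fun_prop)
  rw [integral_integral_swap, ← integral_complex_ofReal]
  · refine integral_congr_ae (Filter.Eventually.of_forall fun t ↦ ?_)
    simp only [shiftCount]
    rw [integral_finsetSum]
    · rw [Complex.ofReal_sum]
      exact Finset.sum_congr rfl fun x _ ↦ integral_eF_dEta hη _
    · intro x _
      refine Integrable.of_bound (C := 1)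
        (continuous_eF.comp (by fun_prop)).measurable.aestronglyMeasurable
        (Filter.Eventually.of_forall fun α ↦ (norm_eF _).le)
  · refine Integrable.of_bound (C := ((intCube s N).card : ℝ))
      (continuous_finsetSum _ fun x _ ↦ hc x).measurable.aestronglyMeasurable
      (Filter.Eventually.of_forall fun z ↦ ?_)
    refine (norm_sum_le _ _).trans ?_
    simp [norm_eF]

section
open ProbabilityTheory

lemma absolutelyContinuous_pi_fin {X : Type*} [MeasurableSpace X] {μ ν : Measure X}
    [SigmaFinite μ] [SigmaFinite ν] (h : μ ≪ ν) (n : ℕ) :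
    Measure.pi (fun _ : Fin n ↦ μ) ≪ Measure.pi (fun _ : Fin n ↦ ν) := by
  induction n with
  | zero =>
    rw [Measure.pi_of_empty (fun _ : Fin 0 ↦ μ), Measure.pi_of_empty (fun _ : Fin 0 ↦ ν)]
  | succ n ih =>
    have h1 := (measurePreserving_piFinSuccAbove (fun _ : Fin (n + 1) ↦ μ) 0).symm.map_eq
    have h2 := (measurePreserving_piFinSuccAbove (fun _ : Fin (n + 1) ↦ ν) 0).symm.map_eq
    rw [← h1, ← h2]
    exact (h.prod ih).map (MeasurableEquiv.measurable _)

lemma volume_absolutelyContinuous_gaussian (s : ℕ) :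
    (volume : Measure (Fin s → ℝ)) ≪ Measure.pi (fun _ : Fin s ↦ gaussianReal 0 1) :=
  absolutelyContinuous_pi_fin (gaussianReal_absolutelyContinuous' 0 one_ne_zero) s

section
variable {k s N : ℕ} {η : ℝ}

/-- The average of `shiftCount` over all translates. -/
noncomputable def meanCount (k s N : ℕ) (η : ℝ) (l : Fin s → ℝ) : ℝ :=
  ∫ t, shiftCount k s N η l t ∂unitCube s

lemma integrable_shiftCount_right (hη : 0 < η) (l : Fin s → ℝ) :
    Integrable (fun t ↦ shiftCount k s N η l t) (unitCube s) := by
  refine Integrable.of_bound (C := ((intCube s N).card : ℝ))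
    (continuous_shiftCount_right k N η l).measurable.aestronglyMeasurable
    (Filter.Eventually.of_forall fun t ↦ ?_)
  rw [Real.norm_of_nonneg (shiftCount_nonneg _ _)]
  exact shiftCount_le_card hη _ _

lemma meanCount_nonneg (l : Fin s → ℝ) : 0 ≤ meanCount k s N η l :=
  integral_nonneg fun _ ↦ shiftCount_nonneg _ _

lemma meanCount_le_card (hη : 0 < η) (l : Fin s → ℝ) :
    meanCount k s N η l ≤ (intCube s N).card := by
  calc _ ≤ ∫ _t, ((intCube s N).card : ℝ) ∂unitCube s :=
        integral_mono (integrable_shiftCount_right hη l) (integrable_const _)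
          fun t ↦ shiftCount_le_card hη l t
    _ = _ := by simp

lemma measurable_meanCount (k s N : ℕ) (η : ℝ) : Measurable (meanCount k s N η) :=
  ((continuous_shiftCount k s N η).measurable.stronglyMeasurable.integral_prod_right'
    (ν := unitCube s)).measurable

lemma sq_sub_meanCount_le (hη : 0 < η) (l a : Fin s → ℝ) :
    (shiftCount k s N η l a - meanCount k s N η l) ^ 2 ≤
      ∫ t, (shiftCount k s N η l a - shiftCount k s N η l t) ^ 2 ∂unitCube s := by
  have hi : Integrable (fun t ↦ shiftCount k s N η l a - shiftCount k s N η l t) (unitCube s) :=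
    (integrable_const _).sub (integrable_shiftCount_right hη l)
  have hc : Continuous fun t ↦ (shiftCount k s N η l a - shiftCount k s N η l t) ^ 2 :=
    (continuous_const.sub (continuous_shiftCount_right k N η l)).pow 2
  have hi2 : Integrable (fun t ↦ (shiftCount k s N η l a - shiftCount k s N η l t) ^ 2)
      (unitCube s) := by
    refine Integrable.of_bound (C := ((intCube s N).card : ℝ) ^ 2)
      hc.measurable.aestronglyMeasurable (Filter.Eventually.of_forall fun t ↦ ?_)
    rw [Real.norm_of_nonneg (sq_nonneg _)]
    refine sq_le_sq' ?_ ?_ <;>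
      linarith [shiftCount_nonneg (k := k) (N := N) (η := η) l a,
        shiftCount_nonneg (k := k) (N := N) (η := η) l t,
        shiftCount_le_card (k := k) (N := N) hη l a, shiftCount_le_card (k := k) (N := N) hη l t]
  have h := (even_two.convexOn_pow (𝕜 := ℝ)).map_integral_le (continuous_pow 2).continuousOn
    isClosed_univ (Filter.Eventually.of_forall fun _ ↦ Set.mem_univ _) hi hi2
  rw [integral_sub (integrable_const _) (integrable_shiftCount_right hη l)] at h
  simpa [meanCount] using h

lemma integrable_sq_sub_meanCount (hη : 0 < η) {μ : Measure (Fin s → ℝ)} [IsFiniteMeasure μ]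
    (a : Fin s → ℝ) :
    Integrable (fun l ↦ (shiftCount k s N η l a - meanCount k s N η l) ^ 2) μ := by
  refine Integrable.of_bound (C := ((intCube s N).card : ℝ) ^ 2)
    (((continuous_shiftCount_left k N η a).measurable.sub
      (measurable_meanCount k s N η)).pow_const 2).aestronglyMeasurable
    (Filter.Eventually.of_forall fun l ↦ ?_)
  rw [Real.norm_of_nonneg (sq_nonneg _)]
  refine sq_le_sq' ?_ ?_ <;>
    linarith [shiftCount_nonneg (k := k) (N := N) (η := η) l a,
      meanCount_nonneg (k := k) (N := N) (η := η) l,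
      shiftCount_le_card (k := k) (N := N) hη l a, meanCount_le_card (k := k) (N := N) hη l]

lemma integral_sq_sub_meanCount_le (hk : 1 ≤ k) (hs : 2 * k < s) (hN : 1 ≤ N)
    (hη : 0 < η) (hη2 : η ≤ 2) :
    ∫ l, (shiftCount k s N η l 0 - meanCount k s N η l) ^ 2
      ∂Measure.pi (fun _ : Fin s ↦ gaussianReal 0 1) ≤
    4 * corrConst k s * (N : ℝ) ^ (2 * (s : ℝ) - 2 * k - 1 / 8) := by
  have hc : Continuous fun z : (Fin s → ℝ) × (Fin s → ℝ) ↦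
      (shiftCount k s N η z.1 0 - shiftCount k s N η z.1 z.2) ^ 2 :=
    (((continuous_shiftCount_left k N η 0).comp continuous_fst).sub
      (continuous_shiftCount k s N η)).pow 2
  have hi : Integrable (Function.uncurry fun (l t : Fin s → ℝ) ↦
      (shiftCount k s N η l 0 - shiftCount k s N η l t) ^ 2)
      ((Measure.pi (fun _ : Fin s ↦ gaussianReal 0 1)).prod (unitCube s)) := by
    refine Integrable.of_bound (C := ((intCube s N).card : ℝ) ^ 2)
      hc.measurable.aestronglyMeasurable (Filter.Eventually.of_forall fun z ↦ ?_)
    simp only [Function.uncurry]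
    rw [Real.norm_of_nonneg (sq_nonneg _)]
    refine sq_le_sq' ?_ ?_ <;>
      linarith [shiftCount_nonneg (k := k) (N := N) (η := η) z.1 0,
        shiftCount_nonneg (k := k) (N := N) (η := η) z.1 z.2,
        shiftCount_le_card (k := k) (N := N) hη z.1 0,
        shiftCount_le_card (k := k) (N := N) hη z.1 z.2]
  calc _ ≤ ∫ l, ∫ t, (shiftCount k s N η l 0 - shiftCount k s N η l t) ^ 2 ∂unitCube s
          ∂Measure.pi (fun _ : Fin s ↦ gaussianReal 0 1) :=
        integral_mono (integrable_sq_sub_meanCount hη 0) hi.integral_prod_left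
          fun l ↦ sq_sub_meanCount_le hη l 0
    _ = ∫ t, ∫ l, (shiftCount k s N η l 0 - shiftCount k s N η l t) ^ 2
          ∂Measure.pi (fun _ : Fin s ↦ gaussianReal 0 1) ∂unitCube s := integral_integral_swap hi
    _ ≤ ∫ _t, 4 * corrConst k s * (N : ℝ) ^ (2 * (s : ℝ) - 2 * k - 1 / 8) ∂unitCube s := by
        refine integral_mono_ae hi.integral_prod_right (integrable_const _) ?_
        filter_upwards [ae_unitCube s] with t ht
        exact integral_shiftCount_sub_sq_le hk hs hN hη hη2 (by simp) ht
    _ = _ := by simp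

end

lemma ae_bddAbove_of_summable_integral {X : Type*} [MeasurableSpace X] {μ : Measure X}
    {f : ℕ → X → ℝ} (h0 : ∀ n x, 0 ≤ f n x) (hi : ∀ n, Integrable (f n) μ)
    (hs : Summable fun n ↦ ∫ x, f n x ∂μ) : ∀ᵐ x ∂μ, ∃ C, 0 ≤ C ∧ ∀ n, f n x ≤ C := by
  have h1 : ∫⁻ x, ∑' n, ENNReal.ofReal (f n x) ∂μ ≠ ⊤ := by
    rw [lintegral_tsum fun n ↦ (hi n).aemeasurable.ennreal_ofReal]
    simp only [← ofReal_integral_eq_lintegral_ofReal (hi _) (Filter.Eventually.of_forall (h0 _))]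
    exact hs.tsum_ofReal_ne_top
  filter_upwards [ae_lt_top' (AEMeasurable.tsum fun n ↦
    (hi n).aemeasurable.ennreal_ofReal) h1] with x hx
  refine ⟨(∑' n, ENNReal.ofReal (f n x)).toReal, ENNReal.toReal_nonneg, fun n ↦ ?_⟩
  rw [← ENNReal.ofReal_le_iff_le_toReal hx.ne]
  exact ENNReal.le_tsum n

lemma ae_abs_sub_meanCount_le {k s : ℕ} (hk : 1 ≤ k) (hs : 2 * k < s) :
    ∀ᵐ l : Fin s → ℝ ∂volume, ∃ C : ℝ, 0 ≤ C ∧ ∀ m : ℕ, 1 ≤ m → ∀ i : ℕ, 1 ≤ i → i ≤ m →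
      |shiftCount k s (m ^ 40) (2 * i / m) l 0 - meanCount k s (m ^ 40) (2 * i / m) l| ≤
        C * ((m : ℝ) ^ 40) ^ (s - k) / m := by
  refine (volume_absolutelyContinuous_gaussian s).ae_le ?_
  set D : ℕ → ℕ → (Fin s → ℝ) → ℝ := fun m i l ↦
    shiftCount k s (m ^ 40) (2 * i / m) l 0 - meanCount k s (m ^ 40) (2 * i / m) l with hD
  set w : ℕ → ℝ := fun m ↦ m ^ 2 / (((m : ℝ) ^ 40) ^ (s - k)) ^ 2 with hw
  set f : ℕ → (Fin s → ℝ) → ℝ := fun m l ↦ ∑ i ∈ Finset.Icc 1 m, w m * D m i l ^ 2 with hf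
  have hw0 : ∀ m, 0 ≤ w m := fun m ↦ by positivity
  have hη : ∀ m i : ℕ, i ∈ Finset.Icc 1 m → 0 < (2 * i / m : ℝ) ∧ (2 * i / m : ℝ) ≤ 2 := by
    intro m i hi
    rw [Finset.mem_Icc] at hi
    have h1 : (1 : ℝ) ≤ i := by exact_mod_cast hi.1
    have h2 : (i : ℝ) ≤ m := by exact_mod_cast hi.2
    refine ⟨by apply div_pos <;> linarith, ?_⟩
    rw [div_le_iff₀ (by linarith)]
    linarith
  have hint : ∀ m i, i ∈ Finset.Icc 1 m → Integrable (fun l ↦ w m * D m i l ^ 2)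
      (Measure.pi (fun _ : Fin s ↦ gaussianReal 0 1)) := fun m i hi ↦
    (integrable_sq_sub_meanCount (hη m i hi).1 0).const_mul _
  have hb : ∀ m, ∫ l, f m l ∂Measure.pi (fun _ : Fin s ↦ gaussianReal 0 1) ≤
      4 * corrConst k s * (1 / (m : ℝ) ^ 2) := by
    intro m
    rcases Nat.eq_zero_or_pos m with rfl | hm
    · simp [hf]
    have hm' : (0 : ℝ) < m := by exact_mod_cast hm
    have e : ((m ^ 40 : ℕ) : ℝ) ^ (2 * (s : ℝ) - 2 * k - 1 / 8) =
        (((m : ℝ) ^ 40) ^ (s - k)) ^ 2 * ((m : ℝ) ^ 5)⁻¹ := by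
      push_cast
      have : ((s - k : ℕ) : ℝ) = (s : ℝ) - k := Nat.cast_sub (by omega)
      rw [← pow_mul, ← Real.rpow_natCast _ ((s - k) * 2), ← Real.rpow_natCast _ 40,
        ← Real.rpow_natCast _ 5, ← Real.rpow_mul hm'.le, ← Real.rpow_mul hm'.le,
        ← Real.rpow_neg hm'.le, ← Real.rpow_add hm']
      congr 1
      push_cast
      rw [this]
      ring
    simp only [hf]
    rw [integral_finsetSum _ fun i hi ↦ hint m i hi]
    calc _ ≤ ∑ i ∈ Finset.Icc 1 m, w m * (4 * corrConst k s *
          ((m ^ 40 : ℕ) : ℝ) ^ (2 * (s : ℝ) - 2 * k - 1 / 8)) := by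
          refine Finset.sum_le_sum fun i hi ↦ ?_
          rw [integral_const_mul]
          exact mul_le_mul_of_nonneg_left (integral_sq_sub_meanCount_le hk hs
            (Nat.one_le_pow _ _ hm) (hη m i hi).1 (hη m i hi).2) (hw0 m)
      _ = _ := by
          rw [Finset.sum_const, Nat.card_Icc, e, hw]
          simp only [nsmul_eq_mul, Nat.add_sub_cancel]
          field_simp
  have hf0 : ∀ m l, 0 ≤ f m l := fun m l ↦
    Finset.sum_nonneg fun i _ ↦ mul_nonneg (hw0 m) (sq_nonneg _)
  have hsum : Summable fun m ↦ ∫ l, f m l ∂Measure.pi (fun _ : Fin s ↦ gaussianReal 0 1) :=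
    Summable.of_nonneg_of_le (fun m ↦ integral_nonneg (hf0 m)) hb
      ((Real.summable_one_div_nat_pow.2 one_lt_two).mul_left _)
  filter_upwards [ae_bddAbove_of_summable_integral hf0
    (fun m ↦ integrable_finsetSum _ fun i hi ↦ hint m i hi) hsum] with l hl
  obtain ⟨C, hC0, hC⟩ := hl
  refine ⟨√C, Real.sqrt_nonneg _, fun m hm i hi him ↦ ?_⟩
  have hm' : (0 : ℝ) < m := by exact_mod_cast hm
  have h1 : w m * D m i l ^ 2 ≤ C :=
    (Finset.single_le_sum (f := fun i ↦ w m * D m i l ^ 2)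
      (fun i _ ↦ mul_nonneg (hw0 m) (sq_nonneg _)) (Finset.mem_Icc.2 ⟨hi, him⟩)).trans (hC m)
  refine abs_le_of_sq_le_sq ?_ (by positivity)
  rw [div_pow, mul_pow, Real.sq_sqrt hC0, le_div_iff₀ (by positivity)]
  rw [hw] at h1
  simp only at h1
  rw [div_mul_eq_mul_div, div_le_iff₀ (by positivity)] at h1
  linarith

end

lemma one_add_pow_le {y : ℝ} (h0 : 0 ≤ y) (h2 : y ≤ 2) (n : ℕ) :
    (1 + y) ^ n ≤ 1 + n * 3 ^ n * y := by
  induction n with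
  | zero => simp
  | succ n ih =>
    have h3 : (1 + y) ^ n ≤ 3 ^ n := pow_le_pow_left₀ (by linarith) (by linarith) n
    have h4 : (0 : ℝ) ≤ 3 ^ n * y := by positivity
    have h5 : (0 : ℝ) ≤ n * (3 ^ n * y) := by positivity
    calc (1 + y) ^ (n + 1) = (1 + y) ^ n + (1 + y) ^ n * y := by ring
      _ ≤ (1 + n * 3 ^ n * y) + 3 ^ n * y := by gcongr
      _ ≤ 1 + ((n + 1 : ℕ) : ℝ) * 3 ^ (n + 1) * y := by
        push_cast
        rw [pow_succ]
        nlinarith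

lemma le_of_grid_below {F : ℝ → ℝ} {J C E p r g η : ℝ} {m : ℕ} (hm : 1 ≤ m) (hJ : 0 ≤ J)
    (hC : 0 ≤ C) (hE : 0 ≤ E) (hp : 0 ≤ p) (hr : 0 ≤ r) (hpr : p ≤ (1 + E) * r) (hη : 0 < η)
    (hη2 : η ≤ 2) (hg : 0 ≤ g) (hF : ∀ η', 0 < η' → η' ≤ η → F η' ≤ g)
    (h : ∀ i : ℕ, 1 ≤ i → i ≤ m → |F (2 * i / m) - 2 * i / m * J * r| ≤ C * r / m) :
    η * J * p - 2 * J * (E * p) - (2 * J + C) / m * r ≤ g := by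
  have hm0 : (0 : ℝ) < m := by exact_mod_cast hm
  have hmain : η * J * p - 2 * J * (E * p) ≤ η * J * r := by
    have h1 : p - E * p ≤ r := by
      have h2 : E * p ≤ E * p + E * (E * r) := by
        have : 0 ≤ E * (E * r) := by positivity
        linarith
      rcases le_or_gt E 1 with h3 | h3
      · have h4 := mul_le_mul_of_nonneg_left hpr (sub_nonneg.2 h3)
        have h5 : 0 ≤ E ^ 2 * r := by positivity
        linear_combination h4 + h5
      · have := mul_le_mul_of_nonneg_right h3.le hp
        linarith
    have h5 := mul_le_mul_of_nonneg_left h1 (by positivity : 0 ≤ η * J)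
    have h6 : η * J * (E * p) ≤ 2 * J * (E * p) := by gcongr
    linarith
  have hi1 : (⌊η * m / 2⌋₊ : ℝ) ≤ η * m / 2 := Nat.floor_le (by positivity)
  have hi2 : η * m / 2 < ⌊η * m / 2⌋₊ + 1 := Nat.lt_floor_add_one _
  generalize ⌊η * m / 2⌋₊ = i at hi1 hi2
  have hηi : η ≤ 2 * i / m + 2 / m := by
    rw [← add_div, le_div_iff₀ hm0]; linarith
  have hη3 : η * J * r ≤ 2 * i / m * J * r + 2 * J / m * r := by
    have := mul_le_mul_of_nonneg_right (mul_le_mul_of_nonneg_right hηi hJ) hr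
    linear_combination this
  have hCm : (2 * J + C) / m * r = 2 * J / m * r + C * r / m := by ring
  have hCR : 0 ≤ C * r / m := by positivity
  rcases Nat.eq_zero_or_pos i with h0 | h0
  · rw [h0] at hη3
    simp only [Nat.cast_zero, mul_zero, zero_div, zero_mul, zero_add] at hη3
    linarith
  · have hη' : (2 * i / m : ℝ) ≤ η := by rw [div_le_iff₀ hm0]; linarith
    have him : i ≤ m := by
      have : (i : ℝ) ≤ m := by nlinarith
      exact_mod_cast this
    have h1 := (abs_le.1 (h i h0 him)).1
    have h2 := hF (2 * i / m) (by positivity) hη'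
    linarith

lemma le_of_grid_above {F : ℝ → ℝ} {J C E p q g η : ℝ} {m : ℕ} (hm : 1 ≤ m) (hJ : 0 ≤ J)
    (hE : 0 ≤ E) (hp : 0 ≤ p) (hq : 0 ≤ q) (hqp : q ≤ (1 + E) * p) (hη : 0 < η)
    (hη2 : η ≤ 2) (hF : ∀ η', η ≤ η' → g ≤ F η')
    (h : ∀ i : ℕ, 1 ≤ i → i ≤ m → |F (2 * i / m) - 2 * i / m * J * q| ≤ C * q / m) :
    g ≤ η * J * p + 2 * J * (E * p) + (2 * J + C) / m * q := by
  have hm0 : (0 : ℝ) < m := by exact_mod_cast hm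
  have hi1 : η * m / 2 ≤ ⌈η * m / 2⌉₊ := Nat.le_ceil _
  have hi2 : (⌈η * m / 2⌉₊ : ℝ) < η * m / 2 + 1 := Nat.ceil_lt_add_one (by positivity)
  have hi0 : 1 ≤ ⌈η * m / 2⌉₊ := Nat.ceil_pos.2 (by positivity)
  have him : ⌈η * m / 2⌉₊ ≤ m := Nat.ceil_le.2 (by nlinarith)
  generalize ⌈η * m / 2⌉₊ = i at hi1 hi2 hi0 him
  have h1 := (abs_le.1 (h i hi0 him)).2
  have h2 := hF (2 * i / m) (by rw [le_div_iff₀ hm0]; linarith)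
  have hηi : 2 * i / (m : ℝ) ≤ η + 2 / m := by
    rw [div_le_iff₀ hm0, add_mul, div_mul_cancel₀ _ hm0.ne']; linarith
  have h3 : 2 * i / (m : ℝ) * J * q ≤ η * J * q + 2 * J / m * q := by
    have := mul_le_mul_of_nonneg_right (mul_le_mul_of_nonneg_right hηi hJ) hq
    linear_combination this
  have h6 : η * J * q ≤ η * J * p + 2 * J * (E * p) := by
    calc _ ≤ η * J * ((1 + E) * p) := by gcongr
      _ = η * J * p + η * J * (E * p) := by ring
      _ ≤ _ := by gcongr
  have hCm : (2 * J + C) / m * q = 2 * J / m * q + C * q / m := by ring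
  linarith

lemma add_one_pow_add_one_le {x : ℝ} (hx : 0 ≤ x) {n : ℕ} (hn : 1 ≤ n) :
    (x + 1) ^ n + 1 ≤ (x + 2) ^ n := by
  obtain ⟨n, rfl⟩ := Nat.exists_eq_add_of_le' hn
  have h1 : (x + 1) ^ n ≤ (x + 2) ^ n := by gcongr; norm_num
  have h2 : 1 ≤ (x + 1) ^ n := one_le_pow₀ (by linarith)
  rw [pow_succ, pow_succ]
  generalize (x + 1) ^ n = y at h1 h2
  generalize (x + 2) ^ n = z at h1
  nlinarith

lemma abs_sub_le_of_grid {G : ℝ → ℝ → ℝ} (hG0 : ∀ P η, 0 ≤ G P η)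
    (hG : ∀ P P' η η', 0 < η → P ≤ P' → η ≤ η' → G P η ≤ G P' η') {J C : ℝ} (hJ : 0 ≤ J)
    (hC : 0 ≤ C) (d n : ℕ) (hn : 1 ≤ n)
    (h : ∀ m : ℕ, 2 ≤ m → ∀ i : ℕ, 1 ≤ i → i ≤ m →
      |G ((m : ℝ) ^ n) (2 * i / m) - 2 * i / m * J * ((m : ℝ) ^ n + 1 / 2) ^ d| ≤
        C * ((m : ℝ) ^ n + 1 / 2) ^ d / m) :
    ∃ B : ℝ, 0 ≤ B ∧ ∀ m : ℕ, 2 ≤ m → ∀ P : ℝ, (m : ℝ) ^ n ≤ P → P ≤ ((m : ℝ) + 1) ^ n →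
      ∀ η : ℝ, 0 < η → η ≤ 2 → |G P η - η * J * P ^ d| ≤ B * P ^ d / m := by
  obtain ⟨K, hK⟩ : ∃ K : ℝ, K = ((n * d : ℕ) : ℝ) * 3 ^ (n * d) * 2 := ⟨_, rfl⟩
  have hK0 : 0 ≤ K := by rw [hK]; positivity
  refine ⟨2 * J * K + (2 * J + C) * (1 + K), by positivity, fun m hm P hP1 hP2 η hη hη2 ↦ ?_⟩
  have hm2 : (2 : ℝ) ≤ m := by exact_mod_cast hm
  have hm0 : (0 : ℝ) < m := by linarith
  have hmp : (0 : ℝ) < (m : ℝ) ^ n := by positivity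
  have hP0 : 0 < P := hmp.trans_le hP1
  have hgrow : ((m : ℝ) + 2) ^ n = (m : ℝ) ^ n * (1 + 2 / m) ^ n := by
    rw [← mul_pow]; congr 1; field_simp
  have hpow : (1 + 2 / (m : ℝ)) ^ (n * d) ≤ 1 + K / m := by
    have := one_add_pow_le (y := 2 / (m : ℝ)) (by positivity)
      (by rw [div_le_iff₀ hm0]; linarith) (n * d)
    rw [hK]
    refine this.trans (le_of_eq ?_)
    ring
  have hKm : 1 + K / m ≤ 1 + K := by
    have : K / m ≤ K := div_le_self hK0 (by linarith)
    linarith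
  have hx : ∀ x y : ℝ, 0 ≤ x → (m : ℝ) ^ n ≤ y → x ≤ ((m : ℝ) + 2) ^ n →
      x ^ d ≤ (1 + K / m) * y ^ d := by
    intro x y hx0 hy hx
    calc x ^ d ≤ ((m : ℝ) ^ n * (1 + 2 / m) ^ n) ^ d := by rw [← hgrow]; gcongr
      _ = (1 + 2 / (m : ℝ)) ^ (n * d) * ((m : ℝ) ^ n) ^ d := by
        rw [mul_pow, ← pow_mul (1 + 2 / (m : ℝ)) n d, mul_comm]
      _ ≤ (1 + K / m) * y ^ d := by gcongr
  have h0 := add_one_pow_add_one_le hm0.le hn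
  have h1 : (m : ℝ) ^ n ≤ ((m : ℝ) + 1) ^ n := by gcongr; linarith
  have hPd : 0 ≤ P ^ d := by positivity
  have hQd : 0 ≤ (((m : ℝ) + 1) ^ n + 1 / 2) ^ d := by positivity
  have hRd : 0 ≤ ((m : ℝ) ^ n + 1 / 2) ^ d := by positivity
  have hQP := hx (((m : ℝ) + 1) ^ n + 1 / 2) P (by positivity) hP1 (by linarith)
  have hRP := hx ((m : ℝ) ^ n + 1 / 2) P (by positivity) hP1 (by linarith)
  have hPR := hx P ((m : ℝ) ^ n + 1 / 2) hP0.le (by linarith) (by linarith)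
  have hgm := h m hm
  have hgm1 := h (m + 1) (by omega)
  push_cast at hgm1
  have lower := le_of_grid_below (F := G ((m : ℝ) ^ n)) (by omega) hJ hC
    (by positivity : 0 ≤ K / m) hPd hRd hPR hη hη2 (hG0 P η)
    (fun η' h0 h1 ↦ hG _ _ _ _ h0 hP1 h1) hgm
  have upper := le_of_grid_above (F := G (((m : ℝ) + 1) ^ n)) (m := m + 1) (by omega) hJ
    (by positivity : 0 ≤ K / m) hPd hQd hQP hη hη2
    (fun η' h1 ↦ hG _ _ _ _ hη hP2 h1) (by push_cast; exact hgm1)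
  push_cast at upper
  have hQP' := hQP.trans (mul_le_mul_of_nonneg_right hKm hPd)
  have hRP' := hRP.trans (mul_le_mul_of_nonneg_right hKm hPd)
  have hdiv : (2 * J + C) / ((m : ℝ) + 1) ≤ (2 * J + C) / m := by gcongr; linarith
  have hJC : 0 ≤ (2 * J + C) / (m : ℝ) := by positivity
  have hl := mul_le_mul_of_nonneg_left hRP' hJC
  have hu := (mul_le_mul_of_nonneg_right hdiv hQd).trans (mul_le_mul_of_nonneg_left hQP' hJC)
  have hsplit : (2 * J * K + (2 * J + C) * (1 + K)) * P ^ d / m =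
      2 * J * (K / m * P ^ d) + (2 * J + C) / m * ((1 + K) * P ^ d) := by ring
  rw [hsplit, abs_le]
  constructor <;> linarith

lemma Icount_nonneg (k s : ℕ) (l : Fin s → ℝ) (P η : ℝ) : 0 ≤ Icount k s l P η :=
  Finset.sum_nonneg fun _ _ ↦ le_max_left _ _

lemma Icount_mono (k s : ℕ) (l : Fin s → ℝ) {P P' η η' : ℝ} (hη : 0 < η) (hP : P ≤ P')
    (hηη' : η ≤ η') : Icount k s l P η ≤ Icount k s l P' η' := by
  unfold Icount
  have hfl := Int.floor_le_floor hP
  refine (Finset.sum_le_sum_of_subset_of_nonneg (Fintype.piFinset_subset _ _ fun _ ↦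
    Finset.Icc_subset_Icc (by omega) hfl) fun _ _ _ ↦ le_max_left _ _).trans
    (Finset.sum_le_sum fun x _ ↦ ?_)
  gcongr

lemma Icount_natCast (k s : ℕ) (l : Fin s → ℝ) (N : ℕ) (η : ℝ) :
    Icount k s l N η = shiftCount k s N η l 0 := by
  simp [Icount, shiftCount, intCube, tent]

lemma exists_mem_LamC {k s : ℕ} {l : Fin s → ℝ} (hl : l ∈ Lam k s) :
    ∃ C, 2 ≤ C ∧ l ∈ LamC k s C := by
  have h0 : ∀ j, 0 < |l j| := fun j ↦ abs_pos.2 (hl.1 j)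
  set C : ℝ := 2 + ∑ j, (|l j| + |l j|⁻¹) with hC
  have hs : ∀ j, |l j| + |l j|⁻¹ ≤ ∑ j, (|l j| + |l j|⁻¹) := fun j ↦
    Finset.single_le_sum (f := fun j ↦ |l j| + |l j|⁻¹) (fun j _ ↦ by positivity)
      (Finset.mem_univ j)
  have hS : 0 ≤ ∑ j, (|l j| + |l j|⁻¹) := Finset.sum_nonneg fun j _ ↦ by positivity
  refine ⟨C, by linarith, hl, fun j ↦ ⟨?_, ?_⟩⟩
  · rw [one_div]
    refine inv_le_of_inv_le₀ (h0 j) ?_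
    linarith [hs j, h0 j]
  · have : 0 < |l j|⁻¹ := inv_pos.2 (h0 j)
    linarith [hs j]

lemma dlt_le {k : ℕ} (hk : 2 ≤ k) : 5 * dlt k / 2 ≤ 1 / 100 := by
  have h : dlt k ≤ ((8 : ℝ) ^ 4)⁻¹ := by
    rw [dlt]
    gcongr
    · norm_num
    · omega
  norm_num at h
  linarith

lemma exists_abs_sub_le_rpow {G : ℝ → ℝ → ℝ} {J B e : ℝ} {d : ℕ} (hB : 0 ≤ B) (he : e ≤ 1 / 100)
    (h : ∀ m : ℕ, 2 ≤ m → ∀ P : ℝ, (m : ℝ) ^ 40 ≤ P → P ≤ ((m : ℝ) + 1) ^ 40 →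
      ∀ η : ℝ, 0 < η → η ≤ 2 → |G P η - η * J * P ^ d| ≤ B * P ^ d / m) :
    ∃ P₀ : ℝ, ∀ P : ℝ, P₀ ≤ P → ∀ η : ℝ, 0 < η → η ≤ 2 →
      |G P η - η * J * P ^ d| ≤ P ^ ((d : ℝ) - e) := by
  refine ⟨max (2 ^ 40) ((2 * B) ^ (100 : ℝ)), fun P hP η hη hη2 ↦ ?_⟩
  have hP1 : (2 : ℝ) ^ 40 ≤ P := (le_max_left _ _).trans hP
  have hP2 : (2 * B) ^ (100 : ℝ) ≤ P := (le_max_right _ _).trans hP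
  have hP0 : 1 ≤ P := le_trans (by norm_num) hP1
  have hP0' : 0 < P := by linarith
  set x : ℝ := P ^ (1 / 40 : ℝ) with hx
  have hx40 : x ^ 40 = P := by
    rw [hx, ← Real.rpow_natCast, ← Real.rpow_mul hP0'.le]; norm_num
  have hx0 : 0 < x := by positivity
  have hx2 : 2 ≤ x := by
    refine le_of_pow_le_pow_left₀ (n := 40) (by norm_num) hx0.le ?_
    rw [hx40]; exact hP1
  have hm1 : (⌊x⌋₊ : ℝ) ≤ x := Nat.floor_le hx0.le
  have hm2 : x < ⌊x⌋₊ + 1 := Nat.lt_floor_add_one x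
  have hm3 : 2 ≤ ⌊x⌋₊ := Nat.le_floor (by exact_mod_cast hx2)
  have hm4 : (2 : ℝ) ≤ ⌊x⌋₊ := by exact_mod_cast hm3
  have h1 := h ⌊x⌋₊ hm3 P (by rw [← hx40]; gcongr) (by rw [← hx40]; gcongr) η hη hη2
  refine h1.trans ?_
  have h2 : x / 2 ≤ ⌊x⌋₊ := by linarith
  have h3 : 2 * B ≤ P ^ (1 / 100 : ℝ) := by
    have := Real.rpow_le_rpow (by positivity) hP2 (by norm_num : (0 : ℝ) ≤ 1 / 100)
    rwa [← Real.rpow_mul (by positivity), show (100 : ℝ) * (1 / 100) = 1 by norm_num,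
      Real.rpow_one] at this
  calc B * P ^ d / ⌊x⌋₊ ≤ B * P ^ d / (x / 2) := by gcongr
    _ = 2 * B * (P ^ d / x) := by field_simp
    _ ≤ P ^ (1 / 100 : ℝ) * (P ^ d / x) := by gcongr
    _ = P ^ ((d : ℝ) + (1 / 100 - 1 / 40)) := by
        rw [hx, Real.rpow_add hP0', Real.rpow_sub hP0', Real.rpow_natCast]; ring
    _ ≤ _ := Real.rpow_le_rpow_of_exponent_le hP0 (by linarith)

/-- Let s > 2k ≥ 4 and δ = 8^{−2k}; let J_{k,s} be the continuous positive
singular-integral function. Then for almost all λ ∈ Λ_k^{(s)} there is P₀ = P₀(λ,k) such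
that |I_λ(P,η) − η J_{k,s}(λ) P^{s−k}| ≤ P^{s−k−5δ/2} for all P ≥ P₀, uniformly in
0 < η ≤ 2. -/
theorem stmt17 (k s : ℕ) (hk : 2 ≤ k) (hs : 2 * k < s)
    (J : (Fin s → ℝ) → ℝ) (hJc : ContinuousOn J (Lam k s))
    (hJp : ∀ l ∈ Lam k s, 0 < J l)
    (hJ : ∀ C : ℝ, 2 ≤ C → ∃ c₀ : ℝ, 0 < c₀ ∧ ∀ P : ℝ, 2 ≤ P →
      ∀ η : ℝ, 0 < η → η ≤ 2 → ∀ l ∈ LamC k s C,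
        ‖(∫ α, ∏ j, vInt k P (l j * α) ∂dEta η) -
            ((η * J l * P ^ ((s : ℝ) - k) : ℝ) : ℂ)‖ ≤ c₀ * P ^ ((s : ℝ) - 2 * k)) :
    ∀ᵐ l : Fin s → ℝ ∂volume, l ∈ Lam k s →
      ∃ P₀ : ℝ, ∀ P : ℝ, P₀ ≤ P → ∀ η : ℝ, 0 < η → η ≤ 2 →
        |Icount k s l P η - η * J l * P ^ ((s : ℝ) - k)|
          ≤ P ^ ((s : ℝ) - k - 5 * dlt k / 2) := by
  filter_upwards [ae_abs_sub_meanCount_le (k := k) (by omega) hs] with l hl hlam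
  obtain ⟨C₁, hC₁, hC⟩ := hl
  obtain ⟨C, hC2, hlC⟩ := exists_mem_LamC hlam
  obtain ⟨c₀, hc₀, hmain⟩ := hJ C hC2
  have hd : ((s - k : ℕ) : ℝ) = (s : ℝ) - k := Nat.cast_sub (by omega)
  obtain ⟨B, hB, hgrid⟩ := abs_sub_le_of_grid (G := Icount k s l) (J := J l) (C := C₁ + c₀)
    (Icount_nonneg k s l) (fun _ _ _ _ h1 h2 h3 ↦ Icount_mono k s l h1 h2 h3) (hJp l hlam).le
    (by positivity) (s - k) 40 (by norm_num) (by
      intro m hm i hi him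
      have hm2 : (2 : ℝ) ≤ m := by exact_mod_cast hm
      have hi1 : (1 : ℝ) ≤ i := by exact_mod_cast hi
      have him' : (i : ℝ) ≤ m := by exact_mod_cast him
      have hη : (0 : ℝ) < 2 * i / m := by positivity
      have hη2 : (2 * i / m : ℝ) ≤ 2 := by
        rw [div_le_iff₀ (by linarith)]; linarith
      have hmN : (m : ℝ) ≤ (m : ℝ) ^ 40 := le_self_pow₀ (by linarith) (by norm_num)
      set R : ℝ := (m : ℝ) ^ 40 + 1 / 2 with hR
      have hR2 : 2 ≤ R := by linarith
      have hcast : (((m ^ 40 : ℕ) : ℝ) + 1 / 2) = R := by push_cast; rfl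
      have h1 := hmain R hR2 _ hη hη2 l hlC
      rw [← hcast, integral_prod_vInt_eq _ hη, hcast, ← Complex.ofReal_sub, Complex.norm_real,
        Real.norm_eq_abs, ← hd, Real.rpow_natCast] at h1
      have h2 := hC m (by omega) i hi him
      rw [← Icount_natCast] at h2
      push_cast at h2
      have h3 : R ^ ((s : ℝ) - 2 * k) ≤ R ^ (s - k) / m := by
        rw [show (s : ℝ) - 2 * k = ((s - k : ℕ) : ℝ) - (k : ℝ) by rw [hd]; ring,
          Real.rpow_sub (by linarith), Real.rpow_natCast, Real.rpow_natCast]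
        gcongr
        calc (m : ℝ) ≤ R := by linarith
          _ ≤ R ^ k := le_self_pow₀ (by linarith) (by omega)
      have h4 : C₁ * ((m : ℝ) ^ 40) ^ (s - k) / m ≤ C₁ * R ^ (s - k) / m := by
        gcongr; linarith
      calc _ ≤ _ := abs_sub_le _ (meanCount k s (m ^ 40) (2 * i / m) l) _
        _ ≤ C₁ * R ^ (s - k) / m + c₀ * (R ^ (s - k) / m) :=
          add_le_add (h2.trans h4) (h1.trans (by gcongr))
        _ = _ := by ring)
  have := exists_abs_sub_le_rpow (e := 5 * dlt k / 2) hB (dlt_le hk) hgrid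
  rw [hd] at this
  simpa only [← hd, Real.rpow_natCast] using this
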